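/- arXiv:0803.0707 — 4 statements merged into one kernel-verified Lean document; each statement's English description precedes it below -/
import Mathlib

section
/- Let p, q, s, k ≥ 1 be integers with p, q, s of the same odd-even parity. Then c^{(s)}_{p,q,k} = Σ_{i,j ≥ 0} binom(p, 2i) (2i−1)!! binom(q, 2j) (2j−1)!! m^{(s)}_{p−2i, q−2j, k}, where (2i−1)!! = Π_{t=1}^{i} (2t−1) with (−1)!! = 1, and where the sum runs over i, j ≥ 0 with 2i ≤ p and 2j ≤ q. -/
/-- The arc relation underlying the "rightmost function" `ψ` of one row of a paired
array: there is an arc from column `c` to column `d` when `c` is an unmarked column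
whose cell in this row is nonempty and the partner (under the matching) of the
rightmost vertex of that cell lies in column `d`.  Here `col : Fin a → Fin k` assigns
a column to each vertex of the given row, `colV : V → Fin k` assigns a column to every
vertex of the whole array, `pr : Fin a → V` sends a vertex of this row to its partner
under the perfect matching, and `R` is the set of marked columns of this row. -/
def RowArc {V : Type*} {a k : ℕ} (col : Fin a → Fin k) (colV : V → Fin k)
    (pr : Fin a → V) (R : Finset (Fin k)) (c d : Fin k) : Prop :=
  c ∉ R ∧ ∃ i : Fin a, col i = c ∧ (∀ i', col i' = c → i' ≤ i) ∧ colV (pr i) = d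

/-- `i` is the rightmost vertex of an unmarked cell in its row (row data `col`,
marked columns `R`). -/
def IsRightmostUnmarked {a k : ℕ} (col : Fin a → Fin k) (R : Finset (Fin k))
    (i : Fin a) : Prop :=
  col i ∉ R ∧ ∀ i', col i' = col i → i' ≤ i

/-- A paired array with parameters `(p, q, s, k)`: an array of cells with 2 rows and
`k` columns, each cell containing an ordered list of vertices, with `p` vertices in
row 1 and `q` in row 2.  Row-1 vertices are canonically labelled by `Fin p` in global
left-to-right reading order, so the row-1 data is exactly a monotone column assignment
`col1 : Fin p → Fin k` (and likewise `col2` for row 2); within a cell, the order of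
the vertices is the order of their labels.  `pairing` is a perfect matching
(fixed-point-free involution) on all the vertices, with exactly `s` mixed pairs.
`marks1`, `marks2` are the nonempty sets of marked cells in rows 1 and 2.  The
`balance`, `nonempty_cond` and forest conditions are as in the paper: the functional
digraph of the rightmost function of each row is a forest whose components are trees
rooted at (all) the marked columns of that row, with all arcs directed toward the
roots (in particular there are `|marks1|`, resp. `|marks2|`, components: every marked
column of a row carries a vertex of that row, arcs stay among such columns, and there
are no directed cycles). -/
structure PairedArray (p q s k : ℕ) where
  col1 : Fin p → Fin k
  col2 : Fin q → Fin k
  mono1 : Monotone col1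
  mono2 : Monotone col2
  pairing : Equiv.Perm (Fin p ⊕ Fin q)
  invol : ∀ v, pairing (pairing v) = v
  fpf : ∀ v, pairing v ≠ v
  marks1 : Finset (Fin k)
  marks2 : Finset (Fin k)
  marks1_nonempty : marks1.Nonempty
  marks2_nonempty : marks2.Nonempty
  mixed_eq : (Finset.univ.filter fun i : Fin p => (pairing (Sum.inl i)).isRight).card = s
  balance : ∀ c : Fin k,
    (Finset.univ.filter fun i : Fin p => col1 i = c ∧ (pairing (Sum.inl i)).isRight).card =
    (Finset.univ.filter fun j : Fin q => col2 j = c ∧ (pairing (Sum.inr j)).isLeft).card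
  nonempty_cond : ∀ c : Fin k, c ∉ marks1 → c ∉ marks2 →
    (∃ i, col1 i = c) ∨ (∃ j, col2 j = c)
  forest1_marks : ∀ c ∈ marks1, ∃ i, col1 i = c
  forest1_closed : ∀ c d : Fin k,
    RowArc col1 (Sum.elim col1 col2) (fun i => pairing (Sum.inl i)) marks1 c d →
    ∃ i, col1 i = d
  forest1_acyclic : ∀ c : Fin k,
    ¬ Relation.TransGen
      (RowArc col1 (Sum.elim col1 col2) (fun i => pairing (Sum.inl i)) marks1) c c
  forest2_marks : ∀ c ∈ marks2, ∃ j, col2 j = c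
  forest2_closed : ∀ c d : Fin k,
    RowArc col2 (Sum.elim col1 col2) (fun j => pairing (Sum.inr j)) marks2 c d →
    ∃ j, col2 j = d
  forest2_acyclic : ∀ c : Fin k,
    ¬ Relation.TransGen
      (RowArc col2 (Sum.elim col1 col2) (fun j => pairing (Sum.inr j)) marks2) c c

/-- A paired array is canonical if each row has exactly one marked cell. -/
def PairedArray.Canonical {p q s k : ℕ} (A : PairedArray p q s k) : Prop :=
  A.marks1.card = 1 ∧ A.marks2.card = 1

/-- A paired array is minimal if it has no redundant pairs: every non-mixed pair
contains a vertex that is rightmost in an unmarked cell. -/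
def PairedArray.Minimal {p q s k : ℕ} (A : PairedArray p q s k) : Prop :=
  (∀ i i' : Fin p, A.pairing (Sum.inl i) = Sum.inl i' →
    IsRightmostUnmarked A.col1 A.marks1 i ∨ IsRightmostUnmarked A.col1 A.marks1 i') ∧
  (∀ j j' : Fin q, A.pairing (Sum.inr j) = Sum.inr j' →
    IsRightmostUnmarked A.col2 A.marks2 j ∨ IsRightmostUnmarked A.col2 A.marks2 j')

/-- A paired array is vertical if all its pairs are mixed. -/
def PairedArray.Vertical {p q s k : ℕ} (A : PairedArray p q s k) : Prop :=
  ∀ i : Fin p, (A.pairing (Sum.inl i)).isRight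

/-- A paired array is full if every column contains at least one vertex. -/
def PairedArray.Full {p q s k : ℕ} (A : PairedArray p q s k) : Prop :=
  ∀ c : Fin k, (∃ i, A.col1 i = c) ∨ (∃ j, A.col2 j = c)

/-- `c^{(s)}_{p,q,k}`: the number of canonical paired arrays. -/
noncomputable def canonCount (p q s k : ℕ) : ℕ :=
  Nat.card {A : PairedArray p q s k // A.Canonical}

/-- `m^{(s)}_{p,q,k}`: the number of minimal canonical paired arrays. -/
noncomputable def minCount (p q s k : ℕ) : ℕ :=
  Nat.card {A : PairedArray p q s k // A.Canonical ∧ A.Minimal}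

/-- `v^{(s)}_{k,i,j}`: the number of vertical paired arrays with parameters
`(s, s, s, k)` having exactly `i + 1` marked cells in row 1 and `j + 1` in row 2. -/
noncomputable def vertCount (s k i j : ℕ) : ℕ :=
  Nat.card {A : PairedArray s s s k //
    A.Vertical ∧ A.marks1.card = i + 1 ∧ A.marks2.card = j + 1}

/-- `f^{(s)}_{k,i,j}`: the number of full vertical paired arrays with parameters
`(s, s, s, k)` having exactly `i + 1` marked cells in row 1 and `j + 1` in row 2. -/
noncomputable def fullVertCount (s k i j : ℕ) : ℕ :=
  Nat.card {A : PairedArray s s s k //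
    A.Vertical ∧ A.marks1.card = i + 1 ∧ A.marks2.card = j + 1 ∧ A.Full}


namespace PAProof

/-- fixed-point-free involutions -/
def Inv (m : ℕ) : Type := {u : Equiv.Perm (Fin m) // (∀ v, u (u v) = v) ∧ ∀ v, u v ≠ v}

lemma prod_odd (i : ℕ) : (∏ t ∈ Finset.Icc 1 i, (2 * t - 1)) * (2 ^ i * i.factorial) = (2 * i).factorial := by
  induction i with
  | zero => simp
  | succ n ih =>
    rw [Finset.prod_Icc_succ_top (by omega), show 2 * (n + 1) = (2 * n + 1) + 1 by ring,
      Nat.factorial_succ, Nat.factorial_succ, Nat.factorial_succ, ← ih]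
    simp only [Nat.add_sub_cancel]
    ring

lemma inv_iff {m : ℕ} (u : Equiv.Perm (Fin m)) :
    ((∀ v, u (u v) = v) ∧ ∀ v, u v ≠ v) ↔
      ((∀ c ∈ u.cycleType, c = 2) ∧ u.cycleType.sum = m) := by
  have : Fact (Nat.Prime 2) := ⟨Nat.prime_two⟩
  rw [← Equiv.Perm.pow_prime_eq_one_iff, Equiv.Perm.sum_cycleType]
  refine and_congr ?_ ?_
  · rw [Equiv.ext_iff]
    simp [pow_two]
  · constructor
    · intro h
      have : u.support = Finset.univ := by
        ext v; simp [h v]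
      rw [this]; simp
    · intro h v
      have : u.support = Finset.univ := by
        rw [← Finset.card_eq_iff_eq_univ]; simpa using h
      have := Finset.mem_univ v
      rw [← ‹u.support = Finset.univ›] at this
      simpa using this

lemma inv_even (i : ℕ) : Nat.card (Inv (2 * i)) = ∏ t ∈ Finset.Icc 1 i, (2 * t - 1) := by
  classical
  have h1 : Nat.card (Inv (2 * i)) =
      (Finset.univ.filter fun g : Equiv.Perm (Fin (2 * i)) =>
        g.cycleType = Multiset.replicate i 2).card := by
    rw [Inv, Nat.card_eq_fintype_card, Fintype.card_subtype]
    congr 1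
    ext u
    simp only [Finset.mem_filter, Finset.mem_univ, true_and]
    rw [inv_iff, Multiset.eq_replicate]
    constructor
    · rintro ⟨h, h'⟩
      refine ⟨?_, h⟩
      rw [Multiset.eq_replicate_card.2 h] at h'
      simp at h'
      omega
    · rintro ⟨h, h'⟩
      refine ⟨h', ?_⟩
      rw [Multiset.eq_replicate_card.2 h', h]
      simp [mul_comm]
  rw [h1, Equiv.Perm.card_of_cycleType, if_pos]
  · simp only [Fintype.card_fin, Multiset.sum_replicate, smul_eq_mul, Multiset.prod_replicate]
    rw [mul_comm i 2, Nat.sub_self]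
    have : (∏ n ∈ (Multiset.replicate i 2).toFinset, ((Multiset.replicate i 2).count n).factorial)
        = i.factorial := by
      rcases Nat.eq_zero_or_pos i with rfl | hi
      · simp
      · rw [Multiset.toFinset_replicate, if_neg hi.ne']
        simp
    rw [this, ← prod_odd]
    simp only [Nat.factorial_zero, one_mul]
    exact Nat.mul_div_cancel _ (by positivity)
  · constructor
    · simp [mul_comm]
    · intro a ha
      rw [Multiset.eq_of_mem_replicate ha]

lemma inv_odd (m : ℕ) (hm : m % 2 = 1) : Nat.card (Inv m) = 0 := by
  rw [Nat.card_eq_zero]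
  left
  constructor
  rintro ⟨u, hu⟩
  obtain ⟨h, h'⟩ := (inv_iff u).1 hu
  rw [Multiset.eq_replicate_card.2 h] at h'
  simp at h'
  omega

/-- raw data of a canonical array -/
@[ext]
structure Dat (p q k : ℕ) where
  col1 : Fin p → Fin k
  col2 : Fin q → Fin k
  pi : Equiv.Perm (Fin p ⊕ Fin q)
  r1 : Fin k
  r2 : Fin k

instance {p q k : ℕ} : Finite (Dat p q k) :=
  Finite.of_injective
    (fun t : Dat p q k => (t.col1, t.col2, t.pi, t.r1, t.r2))
    (by
      intro a b h
      simp only [Prod.mk.injEq] at h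
      obtain ⟨h1, h2, h3, h4, h5⟩ := h
      exact Dat.ext h1 h2 h3 h4 h5)

abbrev Dat.arc1 {p q k : ℕ} (t : Dat p q k) : Fin k → Fin k → Prop :=
  RowArc t.col1 (Sum.elim t.col1 t.col2) (fun i => t.pi (Sum.inl i)) {t.r1}

abbrev Dat.arc2 {p q k : ℕ} (t : Dat p q k) : Fin k → Fin k → Prop :=
  RowArc t.col2 (Sum.elim t.col1 t.col2) (fun i => t.pi (Sum.inr i)) {t.r2}

abbrev Dat.iru1 {p q k : ℕ} (t : Dat p q k) (i : Fin p) : Prop :=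
  IsRightmostUnmarked t.col1 {t.r1} i

abbrev Dat.iru2 {p q k : ℕ} (t : Dat p q k) (i : Fin q) : Prop :=
  IsRightmostUnmarked t.col2 {t.r2} i

def Dat.Red {p q k : ℕ} (t : Dat p q k) (x : Fin p) : Prop :=
  ∃ y, t.pi (Sum.inl x) = Sum.inl y ∧ ¬ t.iru1 x ∧ ¬ t.iru1 y

def Dat.min1 {p q k : ℕ} (t : Dat p q k) : Prop :=
  ∀ i i' : Fin p, t.pi (Sum.inl i) = Sum.inl i' → t.iru1 i ∨ t.iru1 i'

def Dat.min2 {p q k : ℕ} (t : Dat p q k) : Prop :=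
  ∀ i i' : Fin q, t.pi (Sum.inr i) = Sum.inr i' → t.iru2 i ∨ t.iru2 i'

lemma Dat.min1_iff {p q k : ℕ} (t : Dat p q k) : t.min1 ↔ ∀ x, ¬ t.Red x := by
  unfold Dat.min1 Dat.Red
  constructor
  · rintro h x ⟨y, h1, h2, h3⟩
    exact (h x y h1).elim h2 h3
  · intro h i i' hi
    by_contra hc
    rw [not_or] at hc
    exact h i ⟨i', hi, hc⟩

structure Good {p q k : ℕ} (s : ℕ) (t : Dat p q k) : Prop where
  mono2 : Monotone t.col2
  invol : ∀ v, t.pi (t.pi v) = v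
  fpf : ∀ v, t.pi v ≠ v
  mixed_eq : (Finset.univ.filter fun i : Fin p => (t.pi (Sum.inl i)).isRight).card = s
  balance : ∀ c : Fin k,
    (Finset.univ.filter fun i : Fin p => t.col1 i = c ∧ (t.pi (Sum.inl i)).isRight).card =
    (Finset.univ.filter fun j : Fin q => t.col2 j = c ∧ (t.pi (Sum.inr j)).isLeft).card
  nonempty_cond : ∀ c : Fin k, c ∉ ({t.r1} : Finset (Fin k)) → c ∉ ({t.r2} : Finset (Fin k)) →
    (∃ i, t.col1 i = c) ∨ (∃ j, t.col2 j = c)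
  forest1_marks : ∃ i, t.col1 i = t.r1
  forest1_closed : ∀ c d : Fin k, t.arc1 c d → ∃ i, t.col1 i = d
  forest1_acyclic : ∀ c : Fin k, ¬ Relation.TransGen t.arc1 c c
  forest2_marks : ∃ i, t.col2 i = t.r2
  forest2_closed : ∀ c d : Fin k, t.arc2 c d → ∃ i, t.col2 i = d
  forest2_acyclic : ∀ c : Fin k, ¬ Relation.TransGen t.arc2 c c

/-- restriction relation between a big array `t` and a small array `t'` -/
structure Rel {p q k m n : ℕ} (e : Fin m ⊕ Fin n ≃ Fin p) (u : Equiv.Perm (Fin m))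
    (t : Dat p q k) (t' : Dat n q k) : Prop where
  col1 : ∀ y, t'.col1 y = t.col1 (e (Sum.inr y))
  col2 : t'.col2 = t.col2
  r1 : t'.r1 = t.r1
  r2 : t'.r2 = t.r2
  hu : ∀ x, t.pi (Sum.inl (e (Sum.inl x))) = Sum.inl (e (Sum.inl (u x)))
  hw : ∀ v : Fin n ⊕ Fin q, t.pi (Sum.map (fun y => e (Sum.inr y)) id v) =
    Sum.map (fun y => e (Sum.inr y)) id (t'.pi v)
  ord : ∀ y y', t.col1 (e (Sum.inr y)) = t.col1 (e (Sum.inr y')) →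
    (y ≤ y' ↔ e (Sum.inr y) ≤ e (Sum.inr y'))
  ins : ∀ x, t.col1 (e (Sum.inl x)) = t.r1 ∨ ∃ y, t.col1 (e (Sum.inr y)) = t.col1 (e (Sum.inl x)) ∧
    e (Sum.inl x) < e (Sum.inr y)
  root : ∃ y, t.col1 (e (Sum.inr y)) = t.r1
  uinvol : ∀ v, u (u v) = v
  ufpf : ∀ v, u v ≠ v

namespace Rel
variable {p q k m n : ℕ} {e : Fin m ⊕ Fin n ≃ Fin p} {u : Equiv.Perm (Fin m)}
    {t : Dat p q k} {t' : Dat n q k}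

lemma hw1 (h : Rel e u t t') (y : Fin n) : t.pi (Sum.inl (e (Sum.inr y))) =
    Sum.map (fun y => e (Sum.inr y)) id (t'.pi (Sum.inl y)) := by
  simpa using h.hw (Sum.inl y)

lemma hw2 (h : Rel e u t t') (j : Fin q) : t.pi (Sum.inr j) =
    Sum.map (fun y => e (Sum.inr y)) id (t'.pi (Sum.inr j)) := by
  simpa using h.hw (Sum.inr j)

lemma colV (h : Rel e u t t') (v : Fin n ⊕ Fin q) :
    Sum.elim t.col1 t.col2 (Sum.map (fun y => e (Sum.inr y)) id v) =
      Sum.elim t'.col1 t'.col2 v := by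
  rcases v with y | j
  · simp [h.col1]
  · simp [h.col2]

lemma exists1 (h : Rel e u t t') (c : Fin k) : (∃ i, t.col1 i = c) ↔ ∃ i, t'.col1 i = c := by
  constructor
  · rintro ⟨i, hi⟩
    obtain ⟨z, rfl⟩ := e.surjective i
    rcases z with x | y
    · rcases h.ins x with hx | ⟨y, hy, _⟩
      · obtain ⟨y, hy⟩ := h.root
        exact ⟨y, by rw [h.col1, hy, ← hx, hi]⟩
      · exact ⟨y, by rw [h.col1, hy, hi]⟩
    · exact ⟨y, by rw [h.col1, hi]⟩
  · rintro ⟨y, hy⟩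
    exact ⟨_, by rw [← h.col1, hy]⟩

/-- rightmost vertices -/
lemma right_iff (h : Rel e u t t') (y : Fin n) (hr : t.col1 (e (Sum.inr y)) ≠ t.r1) :
    (∀ i', t.col1 i' = t.col1 (e (Sum.inr y)) → i' ≤ e (Sum.inr y)) ↔
      ∀ y', t'.col1 y' = t'.col1 y → y' ≤ y := by
  constructor
  · intro H y' hy'
    rw [h.col1, h.col1] at hy'
    exact (h.ord _ _ hy').2 (H _ hy')
  · intro H i' hi'
    obtain ⟨z, rfl⟩ := e.surjective i'
    rcases z with x | y'
    · rcases h.ins x with hx | ⟨y', hy', hlt⟩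
      · exact absurd (hi'.symm.trans hx) hr
      · have hc := hy'.trans hi'
        exact hlt.le.trans ((h.ord _ _ hc).1 (H y' (by rw [h.col1, h.col1, hc])))
    · exact (h.ord _ _ hi').1 (H _ (by rw [h.col1, h.col1, hi']))

lemma iru1_iff (h : Rel e u t t') (y : Fin n) : t.iru1 (e (Sum.inr y)) ↔ t'.iru1 y := by
  unfold Dat.iru1 IsRightmostUnmarked
  rw [Finset.mem_singleton, Finset.mem_singleton, h.r1, h.col1]
  by_cases hr : t.col1 (e (Sum.inr y)) = t.r1
  · simp [hr]
  · rw [h.right_iff y hr, h.col1]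

lemma not_iru1 (h : Rel e u t t') (x : Fin m) : ¬ t.iru1 (e (Sum.inl x)) := by
  rintro ⟨h1, h2⟩
  rw [Finset.mem_singleton] at h1
  rcases h.ins x with hx | ⟨y, hy, hlt⟩
  · exact h1 hx
  · exact absurd (h2 _ hy) (not_le.2 hlt)

lemma red_inl (h : Rel e u t t') (x : Fin m) : t.Red (e (Sum.inl x)) :=
  ⟨_, h.hu x, h.not_iru1 _, h.not_iru1 _⟩

lemma red_inr (h : Rel e u t t') (y : Fin n) : t.Red (e (Sum.inr y)) ↔ t'.Red y := by
  unfold Dat.Red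
  rw [h.hw1, h.iru1_iff]
  constructor
  · rintro ⟨z, hz, h1, h2⟩
    rcases hv : t'.pi (Sum.inl y) with y' | j
    · rw [hv] at hz
      simp only [Sum.map_inl, Sum.inl.injEq] at hz
      subst hz
      exact ⟨y', rfl, h1, by rwa [← h.iru1_iff]⟩
    · rw [hv] at hz
      simp at hz
  · rintro ⟨z, hz, h1, h2⟩
    exact ⟨e (Sum.inr z), by rw [hz]; simp, h1, by rwa [h.iru1_iff]⟩

lemma min2_iff (h : Rel e u t t') : t.min2 ↔ t'.min2 := by
  unfold Dat.min2 Dat.iru2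
  rw [h.col2, h.r2]
  refine forall_congr' fun i => forall_congr' fun i' => ?_
  rw [h.hw2]
  rcases t'.pi (Sum.inr i) with y' | j <;> simp

lemma arc1_iff (h : Rel e u t t') (c d : Fin k) : t.arc1 c d ↔ t'.arc1 c d := by
  unfold Dat.arc1 RowArc
  rw [Finset.mem_singleton, Finset.mem_singleton, h.r1]
  refine and_congr_right fun hc => ?_
  constructor
  · rintro ⟨i, hi, H, hd⟩
    obtain ⟨z, rfl⟩ := e.surjective i
    rcases z with x | y
    · rcases h.ins x with hx | ⟨y, hy, hlt⟩
      · exact absurd (hi.symm.trans hx) hc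
      · exact absurd (H _ (hy.trans hi)) (not_le.2 hlt)
    · refine ⟨y, by rw [h.col1, hi], ?_, ?_⟩
      · subst hi
        rw [← h.col1]
        exact (h.right_iff y hc).1 H
      · beta_reduce at hd
        rw [h.hw1, h.colV] at hd
        exact hd
  · rintro ⟨y, hi, H, hd⟩
    have hi' := hi
    rw [h.col1] at hi'
    refine ⟨e (Sum.inr y), hi', ?_, ?_⟩
    · subst hi'
      refine (h.right_iff y hc).2 ?_
      rw [h.col1 y]
      exact H
    · beta_reduce
      rw [h.hw1, h.colV]; exact hd

lemma arc2_iff (h : Rel e u t t') (c d : Fin k) : t.arc2 c d ↔ t'.arc2 c d := by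
  unfold Dat.arc2 RowArc
  simp only [h.hw2, h.colV, h.col2, h.r2]

lemma card_filter (e : Fin m ⊕ Fin n ≃ Fin p) (P : Fin p → Prop) [DecidablePred P]
    (Q : Fin n → Prop) [DecidablePred Q] (h1 : ∀ x, ¬ P (e (Sum.inl x)))
    (h2 : ∀ y, P (e (Sum.inr y)) ↔ Q y) :
    (Finset.univ.filter P).card = (Finset.univ.filter Q).card := by
  symm
  refine Finset.card_bij (fun y _ => e (Sum.inr y)) ?_ ?_ ?_
  · intro y hy
    simpa [h2] using hy
  · intro a _ b _ hab
    simpa using hab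
  · intro i hi
    obtain ⟨z, rfl⟩ := e.surjective i
    rcases z with x | y
    · simp [h1] at hi
    · exact ⟨y, by simpa [h2] using hi, rfl⟩

lemma isRight_iff (h : Rel e u t t') (y : Fin n) :
    (t.pi (Sum.inl (e (Sum.inr y)))).isRight = (t'.pi (Sum.inl y)).isRight := by
  rw [h.hw1]; rcases t'.pi (Sum.inl y) with y' | j <;> simp

lemma isLeft_iff (h : Rel e u t t') (y : Fin q) :
    (t.pi (Sum.inr y)).isLeft = (t'.pi (Sum.inr y)).isLeft := by
  rw [h.hw2]; rcases t'.pi (Sum.inr y) with y' | j <;> simp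

lemma mixed_card (h : Rel e u t t') :
    (Finset.univ.filter fun i : Fin p => (t.pi (Sum.inl i)).isRight).card =
    (Finset.univ.filter fun i : Fin n => (t'.pi (Sum.inl i)).isRight).card := by
  refine card_filter e _ _ ?_ ?_
  · intro x; simp [h.hu]
  · intro y; rw [h.isRight_iff]

lemma mixed_card_col (h : Rel e u t t') (c : Fin k) :
    (Finset.univ.filter fun i : Fin p => t.col1 i = c ∧ (t.pi (Sum.inl i)).isRight).card =
    (Finset.univ.filter fun i : Fin n => t'.col1 i = c ∧ (t'.pi (Sum.inl i)).isRight).card := by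
  refine card_filter e _ _ ?_ ?_
  · intro x; simp [h.hu]
  · intro y; rw [h.isRight_iff, h.col1]

lemma J_inj : Function.Injective
    (Sum.map (fun y => e (Sum.inr y)) id : Fin n ⊕ Fin q → Fin p ⊕ Fin q) :=
  Sum.map_injective.2 ⟨fun a b h => by simpa using h, Function.injective_id⟩

lemma cases_v (e : Fin m ⊕ Fin n ≃ Fin p) (v : Fin p ⊕ Fin q) :
    (∃ x, v = Sum.inl (e (Sum.inl x))) ∨ ∃ w, v = Sum.map (fun y => e (Sum.inr y)) id w := by
  rcases v with i | j
  · obtain ⟨z, rfl⟩ := e.surjective i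
    rcases z with x | y
    · exact Or.inl ⟨x, rfl⟩
    · exact Or.inr ⟨Sum.inl y, rfl⟩
  · exact Or.inr ⟨Sum.inr j, rfl⟩

lemma good_iff (h : Rel e u t t') (s : ℕ) : Good s t ↔ Good s t' := by
  have a1 : t.arc1 = t'.arc1 := by ext c d; exact h.arc1_iff c d
  have a2 : t.arc2 = t'.arc2 := by ext c d; exact h.arc2_iff c d
  constructor
  · intro g
    refine ⟨?_, ?_, ?_, ?_, ?_, ?_, ?_, ?_, ?_, ?_, ?_, ?_⟩
    · rw [h.col2]; exact g.mono2
    · intro v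
      apply J_inj (e := e)
      rw [← h.hw, ← h.hw, g.invol]
    · intro v hv
      apply g.fpf (Sum.map (fun y => e (Sum.inr y)) id v)
      rw [h.hw, hv]
    · rw [← h.mixed_card]; exact g.mixed_eq
    · intro c
      rw [← h.mixed_card_col, g.balance c]
      simp only [h.isLeft_iff, h.col2]
    · intro c
      rw [← h.exists1, h.r1, h.r2, h.col2]; exact g.nonempty_cond c
    · rw [← h.exists1, h.r1]; exact g.forest1_marks
    · intro c d
      rw [← h.exists1, ← a1]; exact g.forest1_closed c d
    · rw [← a1]; exact g.forest1_acyclic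
    · rw [h.r2, h.col2]; exact g.forest2_marks
    · rw [← a2, h.col2]; exact g.forest2_closed
    · rw [← a2]; exact g.forest2_acyclic
  · intro g
    refine ⟨?_, ?_, ?_, ?_, ?_, ?_, ?_, ?_, ?_, ?_, ?_, ?_⟩
    · rw [← h.col2]; exact g.mono2
    · intro v
      rcases cases_v e v with ⟨x, rfl⟩ | ⟨w, rfl⟩
      · rw [h.hu, h.hu, h.uinvol]
      · rw [h.hw, h.hw, g.invol]
    · intro v
      rcases cases_v e v with ⟨x, rfl⟩ | ⟨w, rfl⟩
      · rw [h.hu]; simpa using h.ufpf x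
      · rw [h.hw]; intro hv; exact g.fpf w (J_inj hv)
    · rw [h.mixed_card]; exact g.mixed_eq
    · intro c
      rw [h.mixed_card_col, g.balance c]
      simp only [h.isLeft_iff, h.col2]
    · intro c
      rw [h.exists1, ← h.r1, ← h.r2, ← h.col2]; exact g.nonempty_cond c
    · rw [h.exists1, ← h.r1]; exact g.forest1_marks
    · intro c d
      rw [h.exists1, a1]; exact g.forest1_closed c d
    · rw [a1]; exact g.forest1_acyclic
    · rw [← h.r2, ← h.col2]; exact g.forest2_marks
    · rw [a2, ← h.col2]; exact g.forest2_closed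
    · rw [a2]; exact g.forest2_acyclic

end Rel

lemma Good.exists_nonred {p q k s : ℕ} {t : Dat p q k} (g : Good s t) (hs : 1 ≤ s) :
    ∃ x, t.col1 x = t.r1 ∧ ¬ t.Red x := by
  have mixed_nonred : ∀ x, (t.pi (Sum.inl x)).isRight → ¬ t.Red x := by
    rintro x hx ⟨y, hy, _⟩
    rw [hy] at hx; simp at hx
  by_cases hex : ∃ x, t.col1 x = t.r1 ∧ (t.pi (Sum.inl x)).isRight
  · obtain ⟨x, h1, h2⟩ := hex
    exact ⟨x, h1, mixed_nonred x h2⟩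
  obtain ⟨x0, hx0⟩ : ∃ x, (t.pi (Sum.inl x)).isRight := by
    have := g.mixed_eq
    have h : 0 < (Finset.univ.filter fun i : Fin p => (t.pi (Sum.inl i)).isRight).card := by omega
    obtain ⟨x, hx⟩ := Finset.card_pos.1 h
    exact ⟨x, (Finset.mem_filter.1 hx).2⟩
  -- find a column mapped to the root
  obtain ⟨c, hc⟩ : ∃ c, t.arc1 c t.r1 := by
    by_contra hno
    push Not at hno
    let r : Fin k → Fin k → Prop := fun a b => Relation.TransGen t.arc1 b a
    have i1 : IsTrans (Fin k) r := ⟨fun a b c h1 h2 => Relation.TransGen.trans h2 h1⟩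
    have i2 : Std.Irrefl r := ⟨fun a => g.forest1_acyclic a⟩
    have wf : WellFounded r := Finite.wellFounded_of_trans_of_irrefl r
    obtain ⟨c, ⟨⟨i, hi⟩, hc⟩, hmin⟩ := wf.has_min {c | (∃ i, t.col1 i = c) ∧ c ≠ t.r1}
      ⟨t.col1 x0, ⟨x0, rfl⟩, fun h => hex ⟨x0, h, hx0⟩⟩
    obtain ⟨j, hj, hmax⟩ := Finset.exists_max_image (Finset.univ.filter fun i => t.col1 i = c) id
      ⟨i, by simpa using hi⟩
    simp only [Finset.mem_filter, Finset.mem_univ, true_and, id] at hj hmax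
    have harc : t.arc1 c (Sum.elim t.col1 t.col2 (t.pi (Sum.inl j))) :=
      ⟨by simpa using hc, j, hj, hmax, rfl⟩
    refine hmin _ ⟨g.forest1_closed _ _ harc, ?_⟩ (Relation.TransGen.single harc)
    intro h
    rw [h] at harc
    exact hno c harc
  obtain ⟨hcr, i, hi, hmax, hd⟩ := hc
  rcases hv : t.pi (Sum.inl i) with y | j
  · simp only [hv, Sum.elim_inl] at hd
    refine ⟨y, hd, ?_⟩
    rintro ⟨z, hz, h1, h2⟩
    have : t.pi (Sum.inl y) = Sum.inl i := by rw [← hv, g.invol]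
    rw [this] at hz
    simp only [Sum.inl.injEq] at hz
    subst hz
    exact h2 ⟨by rwa [hi], by rwa [hi]⟩
  · exfalso
    simp only [hv, Sum.elim_inr] at hd
    have hb := g.balance t.r1
    have : 0 < (Finset.univ.filter fun j : Fin q =>
        t.col2 j = t.r1 ∧ (t.pi (Sum.inr j)).isLeft).card := by
      refine Finset.card_pos.2 ⟨j, ?_⟩
      have : t.pi (Sum.inr j) = Sum.inl i := by rw [← hv, g.invol]
      simp [hd, this]
    rw [← hb] at this
    obtain ⟨x, hx⟩ := Finset.card_pos.1 this
    exact hex ⟨x, (Finset.mem_filter.1 hx).2⟩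

/-- the set of good data with sorting key `ρ` -/
def T (ρ : ∀ {k : ℕ}, Fin k → Fin k → ℕ) (s : ℕ) (b1 b2 : Prop) (p q k : ℕ) : Type :=
  {t : Dat p q k // (Good s t ∧ (b1 → t.min1) ∧ (b2 → t.min2)) ∧ Monotone (fun i => ρ t.r1 (t.col1 i))}

instance (ρ : ∀ {k : ℕ}, Fin k → Fin k → ℕ) (s : ℕ) (b1 b2 : Prop) (p q k : ℕ) :
    Finite (T ρ s b1 b2 p q k) := by unfold T; infer_instance

def ρ0 {k : ℕ} (_ c : Fin k) : ℕ := c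
def ρ1 {k : ℕ} (r c : Fin k) : ℕ := if c = r then k else c

lemma ρ0_inj {k : ℕ} (r : Fin k) : Function.Injective (ρ0 r) := fun _ _ h => Fin.ext h
lemma ρ1_inj {k : ℕ} (r : Fin k) : Function.Injective (ρ1 r) := by
  intro a b h
  unfold ρ1 at h
  have := a.2
  have := b.2
  split_ifs at h
  · simp_all
  · omega
  · omega
  · exact Fin.ext h
lemma ρ1_max {k : ℕ} (r c : Fin k) : ρ1 r c ≤ ρ1 r r := by
  unfold ρ1
  have := c.2
  split_ifs <;> simp_all

def relabel {p q k : ℕ} (t : Dat p q k) (σ : Equiv.Perm (Fin p)) : Dat p q k where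
  col1 := t.col1 ∘ σ
  col2 := t.col2
  pi := ((Equiv.sumCongr σ (Equiv.refl _)).trans t.pi).trans (Equiv.sumCongr σ (Equiv.refl _)).symm
  r1 := t.r1
  r2 := t.r2

lemma relabel_inj {p q k : ℕ} {t t' : Dat p q k} {σ : Equiv.Perm (Fin p)}
    (h : relabel t σ = relabel t' σ) : t = t' := by
  have h1 := congrArg Dat.col1 h
  have h2 := congrArg Dat.col2 h
  have h3 := congrArg Dat.pi h
  have h4 := congrArg Dat.r1 h
  have h5 := congrArg Dat.r2 h
  simp only [relabel] at h1 h2 h3 h4 h5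
  refine Dat.ext ?_ h2 ?_ h4 h5
  · exact σ.surjective.injective_comp_right h1
  · ext v
    obtain ⟨w, rfl⟩ := (Equiv.sumCongr σ (Equiv.refl (Fin q))).surjective v
    have := congrArg (fun f : Equiv.Perm _ => f w) h3
    simp only [Equiv.trans_apply, EmbeddingLike.apply_eq_iff_eq] at this
    rw [this]

lemma relabel_rel {p q k s : ℕ} {t : Dat p q k} (g : Good s t) (σ : Equiv.Perm (Fin p))
    (hσ : ∀ y y', t.col1 (σ y) = t.col1 (σ y') → (y ≤ y' ↔ σ y ≤ σ y')) :
    Rel ((Equiv.emptySum (Fin 0) (Fin p)).trans σ) 1 t (relabel t σ) := by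
  refine ⟨?_, rfl, rfl, rfl, ?_, ?_, ?_, ?_, ?_, ?_, ?_⟩
  · intro y; simp [relabel]
  · intro x; exact x.elim0
  · have hJ : ∀ w : Fin p ⊕ Fin q, Sum.map (fun y => ((Equiv.emptySum (Fin 0) (Fin p)).trans σ) (Sum.inr y)) id w
        = Equiv.sumCongr σ (Equiv.refl _) w := by
      intro w
      rcases w with y | j <;> simp
    intro v
    rw [hJ, hJ]
    simp [relabel, -Equiv.sumCongr_apply, -Equiv.sumCongr_symm]
  · intro y y' h
    simpa using hσ y y' (by simpa using h)
  · intro x; exact x.elim0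
  · obtain ⟨i, hi⟩ := g.forest1_marks
    exact ⟨σ.symm i, by simpa using hi⟩
  · intro x; exact x.elim0
  · intro x; exact x.elim0

lemma sort_ord {p k : ℕ} (col : Fin p → Fin k) (f : Fin k → ℕ) (y y' : Fin p)
    (h : col (Tuple.sort (f ∘ col) y) = col (Tuple.sort (f ∘ col) y')) :
    y ≤ y' ↔ Tuple.sort (f ∘ col) y ≤ Tuple.sort (f ∘ col) y' := by
  have H := (Tuple.eq_sort_iff (f := f ∘ col) (σ := Tuple.sort (f ∘ col))).1 rfl
  have H2 : ∀ a b, a < b → col (Tuple.sort (f ∘ col) a) = col (Tuple.sort (f ∘ col) b) →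
      Tuple.sort (f ∘ col) a < Tuple.sort (f ∘ col) b :=
    fun a b hab hc => H.2 a b hab (congrArg f hc)
  constructor
  · intro hy
    rcases hy.eq_or_lt with rfl | hy
    · exact le_rfl
    · exact (H2 _ _ hy h).le
  · intro hy
    by_contra hc
    exact absurd (H2 _ _ (not_le.1 hc) h.symm) (not_lt.2 hy)

lemma T_le (ρ ρ' : ∀ {k : ℕ}, Fin k → Fin k → ℕ)
    (hρ : ∀ {k : ℕ} (r : Fin k), Function.Injective (ρ r))
    (s : ℕ) (b1 b2 : Prop) (p q k : ℕ) :
    Nat.card (T ρ s b1 b2 p q k) ≤ Nat.card (T ρ' s b1 b2 p q k) := by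
  refine Nat.card_le_card_of_injective
    (fun t => ⟨relabel t.1 (Tuple.sort (ρ' t.1.r1 ∘ t.1.col1)), ?_⟩) ?_
  · obtain ⟨t, ⟨g, h1, h2⟩, hm⟩ := t
    have hr := relabel_rel g (Tuple.sort (ρ' t.r1 ∘ t.col1)) (sort_ord _ _)
    refine ⟨⟨(hr.good_iff s).1 g, fun hb => ?_, fun hb => hr.min2_iff.1 (h2 hb)⟩, ?_⟩
    · have := h1 hb
      rw [Dat.min1_iff] at this ⊢
      intro x
      rw [← hr.red_inr]
      exact this _
    · exact Tuple.monotone_sort (ρ' t.r1 ∘ t.col1)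
  · rintro ⟨t, ⟨g, h1, h2⟩, hm⟩ ⟨t', ⟨g', h1', h2'⟩, hm'⟩ h
    have h := congrArg Subtype.val h
    simp only at h
    have key : ∀ t : Dat p q k, Monotone (fun i => ρ t.r1 (t.col1 i)) →
        (Tuple.sort (ρ' t.r1 ∘ t.col1)).symm =
          Tuple.sort (ρ (relabel t (Tuple.sort (ρ' t.r1 ∘ t.col1))).r1 ∘
            (relabel t (Tuple.sort (ρ' t.r1 ∘ t.col1))).col1) := by
      intro t hm
      rw [Tuple.eq_sort_iff]
      have ho := sort_ord t.col1 (ρ' t.r1)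
      generalize Tuple.sort (ρ' t.r1 ∘ t.col1) = σ at *
      refine ⟨?_, ?_⟩
      · intro i j hij
        simpa [relabel] using hm hij
      · intro i j hij hc
        have hc' := hρ _ hc
        simp only [relabel, Function.comp_apply, Equiv.apply_symm_apply] at hc'
        by_contra hlt
        have := (ho (σ.symm j) (σ.symm i) (by simpa using hc'.symm)).1 (not_lt.1 hlt)
        simp only [Equiv.apply_symm_apply] at this
        exact absurd this (not_le.2 hij)
    apply Subtype.ext
    have e : Tuple.sort (ρ' t.r1 ∘ t.col1) = Tuple.sort (ρ' t'.r1 ∘ t'.col1) := by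
      have k1 := key t hm
      have k2 := key t' hm'
      rw [h, ← k2] at k1
      exact Equiv.symm_bijective.injective k1
    rw [← e] at h
    exact relabel_inj h

lemma T_eq (s : ℕ) (b1 b2 : Prop) (p q k : ℕ) :
    Nat.card (T ρ0 s b1 b2 p q k) = Nat.card (T ρ1 s b1 b2 p q k) :=
  le_antisymm (T_le _ _ ρ0_inj _ _ _ _ _ _) (T_le _ _ ρ1_inj _ _ _ _ _ _)

def EE {m n p : ℕ} (q : ℕ) (e : Fin m ⊕ Fin n ≃ Fin p) :
    (Fin m ⊕ (Fin n ⊕ Fin q)) ≃ Fin p ⊕ Fin q :=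
  (Equiv.sumAssoc _ _ _).symm.trans (Equiv.sumCongr e (Equiv.refl _))

lemma EE_inl {m n p q : ℕ} (e : Fin m ⊕ Fin n ≃ Fin p) (x : Fin m) :
    EE q e (Sum.inl x) = Sum.inl (e (Sum.inl x)) := by simp [EE]

lemma EE_inr {m n p q : ℕ} (e : Fin m ⊕ Fin n ≃ Fin p) (v : Fin n ⊕ Fin q) :
    EE q e (Sum.inr v) = Sum.map (fun y => e (Sum.inr y)) id v := by
  rcases v with y | j <;> simp [EE]

def glue {m n p q : ℕ} (e : Fin m ⊕ Fin n ≃ Fin p) (u : Equiv.Perm (Fin m))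
    (w : Equiv.Perm (Fin n ⊕ Fin q)) : Equiv.Perm (Fin p ⊕ Fin q) :=
  (EE q e).symm.trans ((Equiv.Perm.sumCongr u w).trans (EE q e))

lemma glue_inl {m n p q : ℕ} (e : Fin m ⊕ Fin n ≃ Fin p) (u : Equiv.Perm (Fin m))
    (w : Equiv.Perm (Fin n ⊕ Fin q)) (x : Fin m) :
    glue e u w (Sum.inl (e (Sum.inl x))) = Sum.inl (e (Sum.inl (u x))) := by
  rw [← EE_inl, ← EE_inl]; simp [glue]

lemma glue_inr {m n p q : ℕ} (e : Fin m ⊕ Fin n ≃ Fin p) (u : Equiv.Perm (Fin m))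
    (w : Equiv.Perm (Fin n ⊕ Fin q)) (v : Fin n ⊕ Fin q) :
    glue e u w (Sum.map (fun y => e (Sum.inr y)) id v) =
      Sum.map (fun y => e (Sum.inr y)) id (w v) := by
  rw [← EE_inr, ← EE_inr]; simp [glue]

lemma exists_ext {n p k : ℕ} (ι : Fin n → Fin p) (hι : StrictMono ι) (col' : Fin n → Fin k)
    (r : Fin k) (hm : Monotone (fun y => ρ1 r (col' y))) :
    ∃ col : Fin p → Fin k, (∀ y, col (ι y) = col' y) ∧ Monotone (fun x => ρ1 r (col x)) ∧
      ∀ x, (∀ y, x ≠ ι y) → col x = r ∨ ∃ y, col (ι y) = col x ∧ x < ι y := by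
  classical
  have hmin : ∀ x, (∃ y, x ≤ ι y) → ∃ y, x ≤ ι y ∧ ∀ y', x ≤ ι y' → y ≤ y' := by
    rintro x ⟨y, hy⟩
    obtain ⟨z, hz, hmz⟩ := Finset.exists_min_image (Finset.univ.filter fun y => x ≤ ι y) id
      ⟨y, by simpa using hy⟩
    exact ⟨z, by simpa using hz, fun y' hy' => hmz y' (by simpa using hy')⟩
  choose g hg1 hg2 using hmin
  let col : Fin p → Fin k := fun x => if h : ∃ y, x ≤ ι y then col' (g x h) else r
  have c1 : ∀ x (h : ∃ y, x ≤ ι y), col x = col' (g x h) := fun x h => dif_pos h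
  have c2 : ∀ x (h : ¬ ∃ y, x ≤ ι y), col x = r := fun x h => dif_neg h
  have c3 : ∀ y, col (ι y) = col' y := by
    intro y
    have h : ∃ y', ι y ≤ ι y' := ⟨y, le_rfl⟩
    rw [c1 _ h]
    congr 1
    exact le_antisymm (hg2 _ h y le_rfl) (hι.le_iff_le.1 (hg1 _ h))
  refine ⟨col, c3, ?_, ?_⟩
  · intro x x' hx
    beta_reduce
    by_cases h' : ∃ y, x' ≤ ι y
    · have h : ∃ y, x ≤ ι y := by
        obtain ⟨y, hy⟩ := h'
        exact ⟨y, hx.trans hy⟩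
      rw [c1 x h, c1 x' h']
      exact hm (hg2 _ h _ (hx.trans (hg1 _ h')))
    · rw [c2 x' h']
      exact ρ1_max _ _
  · intro x hx
    by_cases h : ∃ y, x ≤ ι y
    · right
      exact ⟨g x h, by rw [c3, c1 x h], lt_of_le_of_ne (hg1 x h) (hx _)⟩
    · left
      exact c2 x h

section core
variable {p q k m n : ℕ} {e : Fin m ⊕ Fin n ≃ Fin p} {u u' : Equiv.Perm (Fin m)}
    {t t2 : Dat p q k} {a b : Dat n q k}

lemma Rel.small_unique (h : Rel e u t a) (h' : Rel e u' t b) : u = u' ∧ a = b := by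
  constructor
  · ext x
    have := (h.hu x).symm.trans (h'.hu x)
    simp only [Sum.inl.injEq, EmbeddingLike.apply_eq_iff_eq] at this
    rw [this]
  · refine Dat.ext ?_ ?_ ?_ ?_ ?_
    · funext y; rw [h.col1, h'.col1]
    · rw [h.col2, h'.col2]
    · ext v
      have := (h.hw v).symm.trans (h'.hw v)
      rw [Rel.J_inj this]
    · rw [h.r1, h'.r1]
    · rw [h.r2, h'.r2]

lemma Rel.col_le (h : Rel e u t a) (h' : Rel e u t2 a)
    (hm' : Monotone (fun i => ρ1 t2.r1 (t2.col1 i))) (i : Fin p) :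
    ρ1 a.r1 (t2.col1 i) ≤ ρ1 a.r1 (t.col1 i) := by
  obtain ⟨z, rfl⟩ := e.surjective i
  rcases z with x | y
  · rcases h.ins x with hx | ⟨y, hy, hlt⟩
    · rw [hx, ← h.r1]; exact ρ1_max _ _
    · have := hm' hlt.le
      beta_reduce at this
      rw [← h'.r1] at this
      refine this.trans ?_
      rw [← h'.col1, h.col1, hy]
  · rw [← h'.col1, ← h.col1]

lemma Rel.big_unique (h : Rel e u t a) (h' : Rel e u t2 a)
    (hm : Monotone (fun i => ρ1 t.r1 (t.col1 i)))
    (hm' : Monotone (fun i => ρ1 t2.r1 (t2.col1 i))) : t = t2 := by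
  refine Dat.ext ?_ ?_ ?_ ?_ ?_
  · funext i
    exact ρ1_inj a.r1 (le_antisymm (h'.col_le h hm i) (h.col_le h' hm' i))
  · rw [← h.col2, h'.col2]
  · ext v
    rcases Rel.cases_v e v with ⟨x, rfl⟩ | ⟨w, rfl⟩
    · rw [h.hu, h'.hu]
    · rw [h.hw, h'.hw]
  · rw [← h.r1, h'.r1]
  · rw [← h.r2, h'.r2]

lemma exists_big {s : ℕ} (he : StrictMono fun y => e (Sum.inr y)) (g : Good s a)
    (hm : Monotone (fun i => ρ1 a.r1 (a.col1 i)))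
    (hu : (∀ v, u (u v) = v) ∧ ∀ v, u v ≠ v) :
    ∃ t : Dat p q k, Rel e u t a ∧ Monotone (fun i => ρ1 t.r1 (t.col1 i)) := by
  obtain ⟨col, h1, h2, h3⟩ := exists_ext _ he a.col1 a.r1 hm
  refine ⟨⟨col, a.col2, glue e u a.pi, a.r1, a.r2⟩, ?_, h2⟩
  refine ⟨fun y => (h1 y).symm, rfl, rfl, rfl, glue_inl _ _ _, glue_inr _ _ _, ?_, ?_, ?_,
    hu.1, hu.2⟩
  · intro y y' _
    exact he.le_iff_le.symm
  · intro x
    exact h3 _ (by simp)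
  · obtain ⟨y, hy⟩ := g.forest1_marks
    exact ⟨y, (h1 y).trans hy⟩

lemma Dat.Red.symm {s : ℕ} (g : Good s t) {x y : Fin p} (h : t.Red x)
    (hy : t.pi (Sum.inl x) = Sum.inl y) : t.Red y := by
  obtain ⟨z, hz, h1, h2⟩ := h
  rw [hy] at hz
  simp only [Sum.inl.injEq] at hz
  subst hz
  exact ⟨x, by rw [← hy, g.invol], h2, h1⟩

lemma exists_small {s : ℕ} (hs : 1 ≤ s) (he : StrictMono fun y => e (Sum.inr y)) (g : Good s t)
    (h1 : ∀ x, t.Red (e (Sum.inl x))) (h2 : ∀ y, ¬ t.Red (e (Sum.inr y))) :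
    ∃ (u : Equiv.Perm (Fin m)) (a : Dat n q k), Rel e u t a := by
  let π' : Equiv.Perm (Fin m ⊕ (Fin n ⊕ Fin q)) := (EE q e).trans (t.pi.trans (EE q e).symm)
  have hmaps : Set.MapsTo π' (Set.range Sum.inl) (Set.range Sum.inl) := by
    rintro _ ⟨x, rfl⟩
    obtain ⟨z, hz, -⟩ := h1 x
    have hzr := (h1 x).symm g hz
    obtain ⟨v, rfl⟩ := e.surjective z
    rcases v with x' | y
    · refine ⟨x', ?_⟩
      simp only [π', Equiv.trans_apply, EE_inl, hz]
      rw [← EE_inl, Equiv.symm_apply_apply]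
    · exact absurd hzr (h2 y)
  obtain ⟨⟨u, w⟩, huw⟩ := Equiv.Perm.mem_sumCongrHom_range_of_perm_mapsTo_inl hmaps
  have key : ∀ v, t.pi (EE q e v) = EE q e (Equiv.Perm.sumCongr u w v) := by
    intro v
    have : Equiv.Perm.sumCongr u w v = π' v := by rw [← huw]; rfl
    rw [this]
    simp [π']
  have ku : ∀ x, t.pi (Sum.inl (e (Sum.inl x))) = Sum.inl (e (Sum.inl (u x))) := by
    intro x
    rw [← EE_inl, key]
    simp [EE_inl]
  refine ⟨u, ⟨fun y => t.col1 (e (Sum.inr y)), t.col2, w, t.r1, t.r2⟩, ?_⟩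
  refine ⟨fun y => rfl, rfl, rfl, rfl, ku, ?_, ?_, ?_, ?_, ?_, ?_⟩
  · intro v
    rw [← EE_inr, key, ← EE_inr]
    simp
  · intro y y' _
    exact he.le_iff_le.symm
  · intro x
    by_contra hc
    push Not at hc
    obtain ⟨hr, hc⟩ := hc
    obtain ⟨z, hz, hmz⟩ := Finset.exists_max_image
      (Finset.univ.filter fun i => t.col1 i = t.col1 (e (Sum.inl x))) id
      ⟨e (Sum.inl x), by simp⟩
    simp only [Finset.mem_filter, Finset.mem_univ, true_and, id] at hz hmz
    have hiru : t.iru1 z := ⟨by rw [hz]; simpa using hr, by rw [hz]; exact hmz⟩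
    have hnr : ¬ t.Red z := fun ⟨_, _, h, _⟩ => h hiru
    obtain ⟨v, rfl⟩ := e.surjective z
    rcases v with x' | y
    · exact hnr (h1 x')
    · have l1 := hc y hz
      have l2 := hmz _ rfl
      have := le_antisymm l1 l2
      simp at this
  · obtain ⟨x, hx, hnr⟩ := g.exists_nonred hs
    obtain ⟨v, rfl⟩ := e.surjective x
    rcases v with x' | y
    · exact absurd (h1 x') hnr
    · exact ⟨y, hx⟩
  · intro x
    have := g.invol (Sum.inl (e (Sum.inl x)))
    rw [ku, ku] at this
    simpa using this
  · intro x hx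
    apply g.fpf (Sum.inl (e (Sum.inl x)))
    rw [ku, hx]

end core

lemma core {p q k s m n : ℕ} (hs : 1 ≤ s) (b2 : Prop) (S : Finset (Fin p)) (hS : S.card = m)
    (hn : Sᶜ.card = n) :
    Nat.card {t : T ρ1 s False b2 p q k // ∀ x, t.1.Red x ↔ x ∈ S} =
      Nat.card (Inv m) * Nat.card (T ρ1 s True b2 n q k) := by
  let e := finSumEquivOfFinset hS hn
  have he : StrictMono fun y => e (Sum.inr y) := by
    intro y y' h
    simp only [e, finSumEquivOfFinset_inr]
    exact (Sᶜ.orderEmbOfFin hn).strictMono h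
  have hl : ∀ x, e (Sum.inl x) ∈ S := by
    intro x
    simp only [e, finSumEquivOfFinset_inl]
    exact Finset.orderEmbOfFin_mem _ _ _
  have hr : ∀ y, e (Sum.inr y) ∉ S := by
    intro y
    simp only [e, finSumEquivOfFinset_inr]
    exact Finset.mem_compl.1 (Finset.orderEmbOfFin_mem _ _ _)
  rw [← Nat.card_prod]
  symm
  have step : ∀ a : Inv m × T ρ1 s True b2 n q k,
      ∃ t : {t : T ρ1 s False b2 p q k // ∀ x, t.1.Red x ↔ x ∈ S}, Rel e a.1.1 t.1.1 a.2.1 := by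
    rintro ⟨⟨u, hu⟩, ⟨a, ⟨g, h1, h2⟩, hm⟩⟩
    obtain ⟨t, hrel, hmt⟩ := exists_big he g hm hu
    refine ⟨⟨⟨t, ⟨(hrel.good_iff s).2 g, False.elim, fun hb => hrel.min2_iff.2 (h2 hb)⟩, hmt⟩,
      ?_⟩, hrel⟩
    intro x
    obtain ⟨v, rfl⟩ := e.surjective x
    rcases v with x' | y
    · exact iff_of_true (hrel.red_inl x') (hl x')
    · refine iff_of_false ?_ (hr y)
      rw [hrel.red_inr]
      exact a.min1_iff.1 (h1 trivial) y
  choose F hF using step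
  refine Nat.card_congr (Equiv.ofBijective F ⟨?_, ?_⟩)
  · intro a b hab
    have ha := hF a
    have hb := hF b
    rw [← hab] at hb
    obtain ⟨h1, h2⟩ := ha.small_unique hb
    exact Prod.ext (Subtype.ext h1) (Subtype.ext h2)
  · rintro ⟨⟨t, ⟨g, h1, h2⟩, hm⟩, hred⟩
    obtain ⟨u, a, hrel⟩ := exists_small hs he g (fun x => (hred _).2 (hl x))
      (fun y => fun h => hr y ((hred _).1 h))
    have ga := (hrel.good_iff s).1 g
    have hma : Monotone (fun i => ρ1 a.r1 (a.col1 i)) := by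
      intro y y' hy
      beta_reduce
      rw [hrel.r1, hrel.col1, hrel.col1]
      exact hm (he.monotone hy)
    have hmin : a.min1 := by
      rw [Dat.min1_iff]
      intro y
      rw [← hrel.red_inr]
      exact fun h => hr y ((hred _).1 h)
    refine ⟨(⟨u, hrel.uinvol, hrel.ufpf⟩,
      ⟨a, ⟨ga, fun _ => hmin, fun hb => hrel.min2_iff.1 (h2 hb)⟩, hma⟩), ?_⟩
    apply Subtype.ext
    apply Subtype.ext
    exact (hF _).big_unique hrel (F _).1.2.2 hm

lemma sum_even (p : ℕ) (f : ℕ → ℕ) (hf : ∀ m, m % 2 = 1 → f m = 0) :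
    ∑ m ∈ Finset.range (p + 1), f m = ∑ i ∈ Finset.range (p / 2 + 1), f (2 * i) := by
  symm
  rw [← Finset.sum_image (g := fun i => 2 * i) (f := f) (by intro a _ b _ h; simpa using h)]
  apply Finset.sum_subset
  · intro x hx
    simp only [Finset.mem_image, Finset.mem_range] at hx ⊢
    omega
  · intro x hx hx'
    apply hf
    by_contra hc
    apply hx'
    simp only [Finset.mem_image, Finset.mem_range] at hx ⊢
    exact ⟨x / 2, by omega, by omega⟩

lemma T_sum {p q k s : ℕ} (hs : 1 ≤ s) (b2 : Prop) :
    Nat.card (T ρ1 s False b2 p q k) = ∑ i ∈ Finset.range (p / 2 + 1),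
      p.choose (2 * i) * (∏ t ∈ Finset.Icc 1 i, (2 * t - 1)) *
        Nat.card (T ρ1 s True b2 (p - 2 * i) q k) := by
  classical
  let red : T ρ1 s False b2 p q k → Finset (Fin p) := fun t => Finset.univ.filter fun x => t.1.Red x
  rw [Nat.card_congr (Equiv.sigmaFiberEquiv red).symm, Nat.card_sigma]
  have h1 : ∀ S : Finset (Fin p), Nat.card {t // red t = S} =
      Nat.card (Inv S.card) * Nat.card (T ρ1 s True b2 (p - S.card) q k) := by
    intro S
    rw [← core hs b2 S rfl (by rw [Finset.card_compl, Fintype.card_fin])]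
    refine Nat.card_congr (Equiv.subtypeEquivRight fun t => ?_)
    simp [red, Finset.ext_iff]
  rw [Finset.sum_congr rfl fun S _ => h1 S, ← Finset.powerset_univ,
    Finset.sum_powerset_apply_card
      (fun m => Nat.card (Inv m) * Nat.card (T ρ1 s True b2 (p - m) q k)), Finset.card_univ,
    Fintype.card_fin, sum_even]
  · refine Finset.sum_congr rfl fun i _ => ?_
    rw [inv_even, smul_eq_mul, mul_assoc]
  · intro m hm
    rw [inv_odd m hm]; simp

def PM1 {p q s k : ℕ} (A : PairedArray p q s k) : Prop :=
  ∀ i i' : Fin p, A.pairing (Sum.inl i) = Sum.inl i' →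
    IsRightmostUnmarked A.col1 A.marks1 i ∨ IsRightmostUnmarked A.col1 A.marks1 i'

def PM2 {p q s k : ℕ} (A : PairedArray p q s k) : Prop :=
  ∀ j j' : Fin q, A.pairing (Sum.inr j) = Sum.inr j' →
    IsRightmostUnmarked A.col2 A.marks2 j ∨ IsRightmostUnmarked A.col2 A.marks2 j'

def PC (s : ℕ) (b1 b2 : Prop) (p q k : ℕ) : Type :=
  {A : PairedArray p q s k // A.Canonical ∧ (b1 → PM1 A) ∧ (b2 → PM2 A)}

def ofDat {p q s k : ℕ} (t : Dat p q k) (g : Good s t) (hm : Monotone t.col1) :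
    PairedArray p q s k where
  col1 := t.col1
  col2 := t.col2
  mono1 := hm
  mono2 := g.mono2
  pairing := t.pi
  invol := g.invol
  fpf := g.fpf
  marks1 := {t.r1}
  marks2 := {t.r2}
  marks1_nonempty := by simp
  marks2_nonempty := by simp
  mixed_eq := g.mixed_eq
  balance := g.balance
  nonempty_cond := g.nonempty_cond
  forest1_marks := by
    intro c hc
    rw [Finset.mem_singleton.1 hc]; exact g.forest1_marks
  forest1_closed := g.forest1_closed
  forest1_acyclic := g.forest1_acyclic
  forest2_marks := by
    intro c hc
    rw [Finset.mem_singleton.1 hc]; exact g.forest2_marks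
  forest2_closed := g.forest2_closed
  forest2_acyclic := g.forest2_acyclic

lemma PC_card (s : ℕ) (b1 b2 : Prop) (p q k : ℕ) :
    Nat.card (PC s b1 b2 p q k) = Nat.card (T ρ0 s b1 b2 p q k) := by
  symm
  refine Nat.card_congr (Equiv.ofBijective
    (fun t => ⟨ofDat t.1 t.2.1.1 t.2.2, ⟨by simp [ofDat], by simp [ofDat]⟩,
      t.2.1.2.1, t.2.1.2.2⟩) ⟨?_, ?_⟩)
  · rintro ⟨t, h⟩ ⟨t', h'⟩ heq
    have heq := congrArg Subtype.val heq
    have a1 : t.col1 = t'.col1 := congrArg PairedArray.col1 heq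
    have a2 : t.col2 = t'.col2 := congrArg PairedArray.col2 heq
    have a3 : t.pi = t'.pi := congrArg PairedArray.pairing heq
    have a4 : ({t.r1} : Finset (Fin k)) = {t'.r1} := congrArg PairedArray.marks1 heq
    have a5 : ({t.r2} : Finset (Fin k)) = {t'.r2} := congrArg PairedArray.marks2 heq
    exact Subtype.ext (Dat.ext a1 a2 a3 (Finset.singleton_inj.1 a4) (Finset.singleton_inj.1 a5))
  · rintro ⟨A, ⟨c1, c2⟩, h1, h2⟩
    obtain ⟨r1, hr1⟩ := Finset.card_eq_one.1 c1
    obtain ⟨r2, hr2⟩ := Finset.card_eq_one.1 c2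
    obtain ⟨col1, col2, mono1, mono2, pairing, invol, fpf, marks1, marks2, n1, n2, mixed_eq,
      balance, nonempty_cond, f1, f2, f3, f4, f5, f6⟩ := A
    simp only at hr1 hr2
    subst hr1 hr2
    refine ⟨⟨⟨col1, col2, pairing, r1, r2⟩, ⟨⟨mono2, invol, fpf, mixed_eq, balance, nonempty_cond,
      f1 r1 (by simp), f2, f3, f4 r2 (by simp), f5, f6⟩, h1, h2⟩, mono1⟩, rfl⟩

lemma RowArc_swap {p q k a : ℕ} (col : Fin a → Fin k) (col1 : Fin p → Fin k) (col2 : Fin q → Fin k)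
    (pr : Fin a → Fin p ⊕ Fin q) (R : Finset (Fin k)) :
    RowArc col (Sum.elim col2 col1) (fun i => (pr i).swap) R =
      RowArc col (Sum.elim col1 col2) pr R := by
  have : ∀ v : Fin p ⊕ Fin q, Sum.elim col2 col1 v.swap = Sum.elim col1 col2 v := by
    intro v; rcases v with v | v <;> rfl
  unfold RowArc
  simp only [this]

def swapPA {p q s k : ℕ} (A : PairedArray p q s k) : PairedArray q p s k where
  col1 := A.col2
  col2 := A.col1
  mono1 := A.mono2
  mono2 := A.mono1
  pairing := ((Equiv.sumComm _ _).trans A.pairing).trans (Equiv.sumComm _ _)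
  invol := by intro v; simp [A.invol]
  fpf := by
    intro v hv
    apply A.fpf v.swap
    have := congrArg Sum.swap hv
    simpa using this
  marks1 := A.marks2
  marks2 := A.marks1
  marks1_nonempty := A.marks2_nonempty
  marks2_nonempty := A.marks1_nonempty
  mixed_eq := by
    have h := A.mixed_eq
    rw [Finset.card_eq_sum_card_fiberwise (f := A.col1) (t := Finset.univ)
      (by intro x _; simp)] at h
    rw [Finset.card_eq_sum_card_fiberwise (f := A.col2) (t := Finset.univ)
      (by intro x _; simp)]
    refine Eq.trans ?_ h
    refine Finset.sum_congr rfl fun c _ => ?_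
    have := A.balance c
    simp only [Finset.filter_filter]
    simp only [and_comm] at this ⊢
    simp [this]
  balance := by
    intro c
    simpa using (A.balance c).symm
  nonempty_cond := fun c h1 h2 => (A.nonempty_cond c h2 h1).symm
  forest1_marks := A.forest2_marks
  forest1_closed := by
    intro c d h
    apply A.forest2_closed c d
    rw [← RowArc_swap]
    exact h
  forest1_acyclic := by
    intro c h
    apply A.forest2_acyclic c
    rw [← RowArc_swap]
    exact h
  forest2_marks := A.forest1_marks
  forest2_closed := by
    intro c d h
    apply A.forest1_closed c d
    rw [← RowArc_swap]
    exact h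
  forest2_acyclic := by
    intro c h
    apply A.forest1_acyclic c
    rw [← RowArc_swap]
    exact h

lemma swapPA_swapPA {p q s k : ℕ} (A : PairedArray p q s k) : swapPA (swapPA A) = A := by
  obtain ⟨col1, col2, mono1, mono2, pairing, invol, fpf, marks1, marks2, n1, n2, mixed_eq,
      balance, nonempty_cond, f1, f2, f3, f4, f5, f6⟩ := A
  simp only [swapPA, PairedArray.mk.injEq, true_and, and_true]
  ext v
  simp

lemma PM1_swap {p q s k : ℕ} {A : PairedArray p q s k} (h : PM2 A) : PM1 (swapPA A) := by
  intro i i' hi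
  apply h i i'
  have := congrArg Sum.swap hi
  simpa [swapPA] using this

lemma PM2_swap {p q s k : ℕ} {A : PairedArray p q s k} (h : PM1 A) : PM2 (swapPA A) := by
  intro i i' hi
  apply h i i'
  have := congrArg Sum.swap hi
  simpa [swapPA] using this

lemma PC_swap (s : ℕ) (b1 b2 : Prop) (p q k : ℕ) :
    Nat.card (PC s b1 b2 p q k) = Nat.card (PC s b2 b1 q p k) :=
  Nat.card_congr
    { toFun := fun A => ⟨swapPA A.1, ⟨A.2.1.2, A.2.1.1⟩, fun h => PM1_swap (A.2.2.2 h),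
        fun h => PM2_swap (A.2.2.1 h)⟩
      invFun := fun A => ⟨swapPA A.1, ⟨A.2.1.2, A.2.1.1⟩, fun h => PM1_swap (A.2.2.2 h),
        fun h => PM2_swap (A.2.2.1 h)⟩
      left_inv := fun A => Subtype.ext (swapPA_swapPA A.1)
      right_inv := fun A => Subtype.ext (swapPA_swapPA A.1) }

lemma PC_sum {p q k s : ℕ} (hs : 1 ≤ s) (b2 : Prop) :
    Nat.card (PC s False b2 p q k) = ∑ i ∈ Finset.range (p / 2 + 1),
      p.choose (2 * i) * (∏ t ∈ Finset.Icc 1 i, (2 * t - 1)) *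
        Nat.card (PC s True b2 (p - 2 * i) q k) := by
  rw [PC_card, T_eq, T_sum hs]
  refine Finset.sum_congr rfl fun i _ => ?_
  rw [PC_card, T_eq]

lemma canon_eq (p q s k : ℕ) : canonCount p q s k = Nat.card (PC s False False p q k) :=
  Nat.card_congr (Equiv.subtypeEquivRight fun A => by simp)

lemma min_eq (p q s k : ℕ) : minCount p q s k = Nat.card (PC s True True p q k) :=
  Nat.card_congr (Equiv.subtypeEquivRight fun A => by
    simp [PairedArray.Minimal, PM1, PM2])

end PAProof

/-- Removing redundant pairs: the number of canonical paired arrays in terms of the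
numbers of minimal canonical paired arrays.  Here `(2i-1)!! = ∏_{t=1}^{i} (2t-1)`,
with `(-1)!! = 1`. -/
theorem canonical_eq_sum_minimal (p q s k : ℕ) (hp : 1 ≤ p) (hq : 1 ≤ q)
    (hs : 1 ≤ s) (hk : 1 ≤ k) (hps : p % 2 = s % 2) (hqs : q % 2 = s % 2) :
    canonCount p q s k =
      ∑ i ∈ Finset.range (p / 2 + 1), ∑ j ∈ Finset.range (q / 2 + 1),
        p.choose (2 * i) * (∏ t ∈ Finset.Icc 1 i, (2 * t - 1)) *
          (q.choose (2 * j)) * (∏ t ∈ Finset.Icc 1 j, (2 * t - 1)) *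
          minCount (p - 2 * i) (q - 2 * j) s k := by
  rw [PAProof.canon_eq, PAProof.PC_sum hs]
  refine Finset.sum_congr rfl fun i _ => ?_
  rw [PAProof.PC_swap, PAProof.PC_sum hs, Finset.mul_sum]
  refine Finset.sum_congr rfl fun j _ => ?_
  rw [PAProof.PC_swap, PAProof.min_eq]
  ring
end

section
/- Let k ≥ 1 and let F be a rooted forest on vertex set [k] = {1,…,k} whose components are rooted trees T_1, …, T_{m+n} with m, n ≥ 1, where T_1, …, T_m are rooted at vertices r_1, …, r_m and T_{m+1}, …, T_{m+n} are rooted at vertices s_1, …, s_n, and let S be the union of the vertex sets of T_{m+1}, …, T_{m+n}. Then there is a bijection between [k]^{m−1} × S and the set of rooted forests on vertex set [k] with root set {s_1, …, s_n} that contain F as a subforest; in particular, the number of such rooted forests equals k^{m−1} · |S|. -/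
/-- `f : Fin k → Fin k` encodes a rooted forest on vertex set `[k]` with root set `W`:
each root `w ∈ W` is a fixed point of `f` (encoding "no outgoing arc"), the arcs are
`v → f v` for `v ∉ W`, and from every vertex the iteration of `f` eventually reaches a
root (this is equivalent to having no directed cycles, every non-root having exactly
one outgoing arc). -/
def IsRootedForest {k : ℕ} (W : Finset (Fin k)) (f : Fin k → Fin k) : Prop :=
  (∀ w ∈ W, f w = w) ∧ ∀ v, ∃ m, f^[m] v ∈ W

theorem fc_fix {k : ℕ} {W : Finset (Fin k)} {f : Fin k → Fin k} (hf : ∀ w ∈ W, f w = w)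
    (j : ℕ) (u : Fin k) : (∃ m, f^[m] (f^[j] u) ∈ W) ↔ ∃ m, f^[m] u ∈ W := by
  constructor
  · rintro ⟨m, h⟩
    exact ⟨m + j, by rwa [Function.iterate_add_apply]⟩
  · rintro ⟨m, h⟩
    refine ⟨m, ?_⟩
    rw [← Function.iterate_add_apply, add_comm, Function.iterate_add_apply,
      Function.iterate_fixed (hf _ h)]
    exact h

theorem fc_agree {k : ℕ} {F g : Fin k → Fin k} {r : Fin k}
    (h : ∀ u, F u ≠ u → g u = F u) (m : ℕ) :
    ∀ u, F^[m] u = r → ∃ m', g^[m'] u = r := by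
  induction m with
  | zero => intro u hu; exact ⟨0, hu⟩
  | succ m ih =>
    intro u hu
    rw [Function.iterate_succ_apply] at hu
    by_cases hfu : F u = u
    · rw [hfu] at hu; exact ih u hu
    · obtain ⟨m', hm'⟩ := ih _ hu
      exact ⟨m' + 1, by rw [Function.iterate_succ_apply, h u hfu, hm']⟩

theorem fc_off {k : ℕ} {F : Fin k → Fin k} {r v u : Fin k}
    (h : ¬ ∃ m, F^[m] u = r) (j : ℕ) : (Function.update F r v)^[j] u = F^[j] u := by
  induction j with
  | zero => rfl
  | succ j ih =>
    rw [Function.iterate_succ_apply', Function.iterate_succ_apply', ih,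
      Function.update_of_ne]
    exact fun e => h ⟨j, e⟩

theorem fc_on {k : ℕ} {F : Fin k → Fin k} {r v u : Fin k} (hr : F r = r)
    (h : ∃ m, F^[m] u = r) : ∃ m, (Function.update F r v)^[m] u = v := by
  obtain ⟨m, hm⟩ := h
  obtain ⟨m', hm'⟩ := fc_agree (g := Function.update F r v) (r := r) (F := F) (by
    intro u hu
    rw [Function.update_of_ne]
    rintro rfl
    exact hu hr) m u hm
  exact ⟨m' + 1, by rw [Function.iterate_succ_apply', hm', Function.update_self]⟩

open Classical in
theorem fc_count {k : ℕ} (W : Finset (Fin k)) (R : Finset (Fin k)) :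
    ∀ F : Fin k → Fin k, Disjoint R W → IsRootedForest (R ∪ W) F →
    k * (Finset.univ.filter (fun G : Fin k → Fin k =>
      IsRootedForest W G ∧ ∀ v, v ∉ R ∪ W → G v = F v)).card =
    k ^ R.card * (Finset.univ.filter (fun v : Fin k => ∃ m, F^[m] v ∈ W)).card := by
  induction R using Finset.induction_on with
  | empty =>
    intro F _ hF
    rw [Finset.empty_union] at hF
    have h1 : (Finset.univ.filter (fun v : Fin k => ∃ m, F^[m] v ∈ W)) = Finset.univ :=
      Finset.filter_true_of_mem fun v _ => hF.2 v
    have h2 : (Finset.univ.filter (fun G : Fin k → Fin k =>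
      IsRootedForest W G ∧ ∀ v, v ∉ ∅ ∪ W → G v = F v)) = {F} := by
      ext G
      simp only [Finset.mem_filter, Finset.mem_univ, true_and, Finset.empty_union,
        Finset.mem_singleton]
      constructor
      · rintro ⟨hG, h⟩
        funext v
        by_cases hv : v ∈ W
        · rw [hG.1 v hv, hF.1 v hv]
        · exact h v hv
      · rintro rfl
        exact ⟨hF, fun _ _ => rfl⟩
    rw [h1, h2]; simp
  | insert r R hrR ih =>
    intro F hd hF
    have hrW : r ∉ W := by
      rw [Finset.disjoint_left] at hd
      exact hd (Finset.mem_insert_self _ _)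
    have hdR : Disjoint R W := hd.mono_left (Finset.subset_insert _ _)
    have hr : F r = r := hF.1 r (by simp)
    have hFW : ∀ w ∈ W, F w = w := fun w hw => hF.1 w (by simp [hw])
    set S := Finset.univ.filter (fun v : Fin k => ∃ m, F^[m] v ∈ W) with hS
    set T := Finset.univ.filter (fun v : Fin k => ∃ m, F^[m] v = r) with hT
    have mS : ∀ u, u ∈ S ↔ ∃ m, F^[m] u ∈ W := by simp [hS]
    have mT : ∀ u, u ∈ T ↔ ∃ m, F^[m] u = r := by simp [hT]
    have hST : ∀ u, u ∈ S → u ∉ T := by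
      intro u hu hu'
      rw [mS] at hu
      rw [mT] at hu'
      obtain ⟨j, hj⟩ := hu'
      rw [← fc_fix hFW j, hj] at hu
      obtain ⟨m, hm⟩ := hu
      rw [Function.iterate_fixed hr] at hm
      exact hrW hm
    set C := Finset.univ.filter (fun G : Fin k → Fin k =>
      IsRootedForest W G ∧ ∀ v, v ∉ insert r R ∪ W → G v = F v) with hC
    have hsum : C.card = ∑ v : Fin k, (C.filter (fun G => G r = v)).card :=
      Finset.card_eq_sum_card_fiberwise (fun _ _ => Finset.mem_coe.2 (Finset.mem_univ _))
    have hfib : ∀ v : Fin k, k * (C.filter (fun G => G r = v)).card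
        + (if v ∈ T then k ^ R.card * S.card else 0)
        = k ^ R.card * S.card + (if v ∈ S then k ^ R.card * T.card else 0) := by
      intro v
      by_cases hv : v ∈ T
      · have hvS : v ∉ S := fun h => hST v h hv
        have : C.filter (fun G => G r = v) = ∅ := by
          rw [Finset.filter_eq_empty_iff]
          intro G hG hGr
          simp only [hC, Finset.mem_filter, Finset.mem_univ, true_and] at hG
          obtain ⟨hG, hGF⟩ := hG
          obtain ⟨m, hm⟩ := (mT v).1 hv
          obtain ⟨m', hm'⟩ := fc_agree (g := G) (r := r) (F := F) (by
            intro u hu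
            apply hGF
            intro hu'
            exact hu (hF.1 u hu')) m v hm
          have hper : G^[m' + 1] r = r := by
            rw [Function.iterate_succ_apply, hGr, hm']
          obtain ⟨n, hn⟩ := hG.2 r
          have h1 : G^[n * (m' + 1)] r = r := by
            rw [mul_comm, Function.iterate_mul, Function.iterate_fixed hper]
          have h2 : G^[n * (m' + 1)] r = G^[n] r := by
            rw [mul_add, mul_one, Function.iterate_add_apply,
              Function.iterate_fixed (hG.1 _ hn)]
          rw [← h2, h1] at hn
          exact hrW hn
        simp [this, hv, hvS]
      · have hfc : C.filter (fun G => G r = v) =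
            Finset.univ.filter (fun G : Fin k → Fin k =>
              IsRootedForest W G ∧ ∀ u, u ∉ R ∪ W → G u = Function.update F r v u) := by
          ext G
          simp only [hC, Finset.mem_filter, Finset.mem_univ, true_and]
          constructor
          · rintro ⟨⟨hG, h⟩, hGr⟩
            refine ⟨hG, fun u hu => ?_⟩
            by_cases hur : u = r
            · subst hur; simp [hGr]
            · rw [Function.update_of_ne hur]
              apply h
              simp only [Finset.mem_union, Finset.mem_insert] at hu ⊢
              tauto
          · rintro ⟨hG, h⟩
            refine ⟨⟨hG, fun u hu => ?_⟩, ?_⟩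
            · simp only [Finset.mem_union, Finset.mem_insert] at hu
              rw [h u (by simp only [Finset.mem_union]; tauto), Function.update_of_ne]
              tauto
            · rw [h r (by simp [hrR, hrW]), Function.update_self]
        have hvT : ¬ ∃ m, F^[m] v = r := fun h => hv ((mT v).2 h)
        have hfix' : ∀ w ∈ R ∪ W, Function.update F r v w = w := by
          intro w hw
          rw [Function.update_of_ne]
          · exact hF.1 w (by simp only [Finset.mem_union, Finset.mem_insert] at hw ⊢; tauto)
          · rintro rfl
            simp [hrR, hrW] at hw
        have hoff : ∀ u, (¬ ∃ m, F^[m] u = r) →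
            ∃ m, (Function.update F r v)^[m] u ∈ R ∪ W := by
          intro u hu
          obtain ⟨m, hm⟩ := hF.2 u
          refine ⟨m, ?_⟩
          rw [fc_off hu]
          have : F^[m] u ≠ r := fun e => hu ⟨m, e⟩
          simp only [Finset.mem_union, Finset.mem_insert] at hm ⊢
          tauto
        have hF' : IsRootedForest (R ∪ W) (Function.update F r v) := by
          refine ⟨hfix', fun u => ?_⟩
          by_cases hu : ∃ m, F^[m] u = r
          · obtain ⟨j, hj⟩ := fc_on (v := v) hr hu
            rw [← fc_fix hfix' j, hj]
            exact hoff v hvT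
          · exact hoff u hu
        have hS' : (Finset.univ.filter
            (fun u : Fin k => ∃ m, (Function.update F r v)^[m] u ∈ W)) =
            S ∪ (if v ∈ S then T else ∅) := by
          ext u
          have hfixW : ∀ w ∈ W, Function.update F r v w = w :=
            fun w hw => hfix' w (Finset.mem_union_right _ hw)
          simp only [Finset.mem_filter, Finset.mem_univ, true_and, Finset.mem_union]
          by_cases hu : ∃ m, F^[m] u = r
          · obtain ⟨j, hj⟩ := fc_on (v := v) hr hu
            have huT : u ∈ T := (mT u).2 hu
            have huS : u ∉ S := fun h => hST u h huT
            rw [← fc_fix hfixW j, hj]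
            simp only [fc_off hvT]
            rw [← mS v]
            by_cases hvS : v ∈ S <;> simp [hvS, huS, huT]
          · have huT : u ∉ T := fun h => hu ((mT u).1 h)
            simp only [fc_off hu]
            rw [← mS u]
            by_cases hvS : v ∈ S <;> simp [hvS, huT]
        rw [hfc, ih _ hdR hF', hS', if_neg hv, add_zero]
        by_cases hvS : v ∈ S
        · rw [if_pos hvS, if_pos hvS,
            Finset.card_union_of_disjoint (Finset.disjoint_left.2 fun {u} h => hST u h), mul_add]
        · simp [hvS]
    have htot := Finset.sum_congr (rfl : (Finset.univ : Finset (Fin k)) = Finset.univ)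
      (fun v _ => hfib v)
    rw [Finset.sum_add_distrib, Finset.sum_add_distrib, ← Finset.mul_sum, ← hsum] at htot
    simp only [Finset.sum_ite_mem, Finset.univ_inter, Finset.sum_const, Finset.card_univ,
      Fintype.card_fin, smul_eq_mul] at htot
    rw [Finset.card_insert_of_notMem hrR, pow_succ]
    have e : T.card * (k ^ R.card * S.card) = S.card * (k ^ R.card * T.card) := by ring
    rw [e] at htot
    have := Nat.add_right_cancel htot
    rw [this]; ring

/-- Forest Completion Theorem.  Let `F` be a rooted forest on `[k]` whose components
are rooted at the vertices of `R ∪ W` (`R`, `W` disjoint and nonempty; `m = |R|`,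
`n = |W|`), and let `S` be the union of the vertex sets of the components rooted at
elements of `W` (the vertices from which `F` reaches `W`).  Then there is a bijection
between `[k]^(m-1) × S` and the set of rooted forests on `[k]` with root set `W`
containing `F` as a subforest (i.e. agreeing with `F` on every non-root vertex of
`F`); in particular, the number of such rooted forests is `k^(m-1) · |S|`. -/
theorem forest_completion (k : ℕ) (hk : 1 ≤ k) (R W : Finset (Fin k))
    (hRW : Disjoint R W) (hR : R.Nonempty) (hW : W.Nonempty)
    (F : Fin k → Fin k) (hF : IsRootedForest (R ∪ W) F) :
    Nonempty (((Fin (R.card - 1) → Fin k) × {v : Fin k // ∃ m, F^[m] v ∈ W}) ≃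
        {G : Fin k → Fin k // IsRootedForest W G ∧ ∀ v, v ∉ R ∪ W → G v = F v}) ∧
      Nat.card {G : Fin k → Fin k // IsRootedForest W G ∧ ∀ v, v ∉ R ∪ W → G v = F v} =
        k ^ (R.card - 1) * Nat.card {v : Fin k // ∃ m, F^[m] v ∈ W} := by
  classical
  have hcount := fc_count W R F hRW hF
  have hcard : Nat.card {G : Fin k → Fin k // IsRootedForest W G ∧ ∀ v, v ∉ R ∪ W → G v = F v} =
        k ^ (R.card - 1) * Nat.card {v : Fin k // ∃ m, F^[m] v ∈ W} := by
    rw [Nat.card_eq_fintype_card, Nat.card_eq_fintype_card, Fintype.card_subtype,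
      Fintype.card_subtype]
    have hp : k ^ R.card = k * k ^ (R.card - 1) := by
      rw [← pow_succ', Nat.sub_add_cancel hR.card_pos]
    rw [hp, mul_assoc] at hcount
    convert Nat.eq_of_mul_eq_mul_left hk hcount
  refine ⟨?_, hcard⟩
  rw [← Finite.card_eq, hcard, Nat.card_prod]
  simp
end

section
/- Let i, j ≥ 0 and k, s ≥ 1 be integers. Then f^{(s)}_{k,i,j} = s! · Σ_{l=0}^{k−1} binom(s−1−l, k−1−l) · binom(k−1−l, i) · binom(k−1−l, j), with the convention that binomial coefficients with negative lower entry or with lower entry exceeding the upper entry are 0. -/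
/-- `binom(a, b)` for integers, with the convention that it is `0` unless `0 ≤ b ≤ a`. -/
def ichoose (a b : ℤ) : ℤ := if 0 ≤ b ∧ b ≤ a then (a.toNat).choose b.toNat else 0

section Gen
open Finset
open scoped Classical
set_option linter.unusedSectionVars false

variable {V K : Type} [Fintype V] [Fintype K] [DecidableEq V] [DecidableEq K]

def Acy (f : K → Option K) : Prop := ∃ h : K → ℕ, ∀ z e, f z = some e → h e < h z

def IsTerm (f : K → Option K) (t : K → K) : Prop :=
  ∀ z, (f z = none → t z = z) ∧ ∀ e, f z = some e → t z = t e

theorem Acy.exists_term {f : K → Option K} (hf : Acy f) : ∃ t, IsTerm f t := by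
  obtain ⟨h, hh⟩ := hf
  have key : ∀ n : ℕ, ∃ t : K → K, ∀ z, h z < n →
      (f z = none → t z = z) ∧ ∀ e, f z = some e → t z = t e := by
    intro n
    induction n with
    | zero => exact ⟨id, by simp⟩
    | succ n ih =>
      obtain ⟨t, ht⟩ := ih
      refine ⟨fun z => if h z < n then t z else match f z with
        | none => z
        | some e => t e, ?_⟩
      intro z hz
      by_cases hzn : h z < n
      · refine ⟨fun hfz => by simp [hzn, (ht z hzn).1 hfz], fun e he => ?_⟩
        have := hh z e he
        have h2 : h e < n := by omega
        simp [hzn, h2, (ht z hzn).2 e he]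
      · refine ⟨fun hfz => by simp [hzn, hfz], fun e he => ?_⟩
        have := hh z e he
        have h2 : h e < n := by omega
        simp [hzn, h2, he]
  obtain ⟨t, ht⟩ := key (Finset.univ.sup h + 1)
  exact ⟨t, fun z => ht z (Nat.lt_succ_of_le (Finset.le_sup (Finset.mem_univ z)))⟩

theorem Acy.term_none {f : K → Option K} (hf : Acy f) {t : K → K} (ht : IsTerm f t) (z : K) :
    f (t z) = none := by
  obtain ⟨h, hh⟩ := hf
  induction hn : h z using Nat.strong_induction_on generalizing z with
  | _ n ih =>
    cases hz : f z with
    | none => rw [(ht z).1 hz, hz]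
    | some e =>
      rw [(ht z).2 e hz]
      exact ih (h e) (hn ▸ hh z e hz) e rfl

theorem Acy.update {f : K → Option K} (hf : Acy f) {t : K → K} (ht : IsTerm f t) {c e : K}
    (hc : f c = none) (he : t e ≠ c) : Acy (Function.update f c (some e)) := by
  obtain ⟨h, hh⟩ := hf
  have htc := (ht c).1 hc
  refine ⟨fun z => if t z = c then h z + h e + 1 else h z, fun z e' hz => ?_⟩
  by_cases hzc : z = c
  · subst hzc
    simp at hz
    subst hz
    simp [he, htc]
  · rw [Function.update_of_ne hzc] at hz
    have h1 := hh z e' hz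
    have h2 := (ht z).2 e' hz
    simp only [h2]
    split_ifs <;> omega

theorem IsTerm.update {f : K → Option K} {t : K → K} (ht : IsTerm f t) {c e : K}
    (hc : f c = none) (he : t e ≠ c) :
    IsTerm (Function.update f c (some e)) (fun z => if t z = c then t e else t z) := by
  have htc := (ht c).1 hc
  intro z
  by_cases hzc : z = c
  · subst hzc
    simp [htc, he]
  · rw [Function.update_of_ne hzc]
    refine ⟨fun hz => ?_, fun e' hz => ?_⟩
    · simp [(ht z).1 hz, hzc]
    · simp [(ht z).2 e' hz]

theorem not_acy_update {f : K → Option K} (hf : Acy f) {t : K → K} (ht : IsTerm f t) {c e : K}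
    (hc : f c = none) (he : t e = c) : ¬ Acy (Function.update f c (some e)) := by
  rintro ⟨h', hh'⟩
  have hnew := hh' c e (by simp)
  obtain ⟨h, hh⟩ := hf
  have key : ∀ z, h' (t z) ≤ h' z := by
    intro z
    induction hn : h z using Nat.strong_induction_on generalizing z with
    | _ n ih =>
      cases hz : f z with
      | none => rw [(ht z).1 hz]
      | some e =>
        rw [(ht z).2 e hz]
        have hzc : z ≠ c := by rintro rfl; simp [hc] at hz
        have h1 := hh' z e (by rw [Function.update_of_ne hzc, hz])
        have := ih (h e) (hn ▸ hh z e hz) e rfl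
        omega
  have := key e
  rw [he] at this
  omega

/-- revealed arcs -/
noncomputable def pf (col : V → K) (last : K → V) (π : Equiv.Perm V) (R : Finset K)
    (D : Finset V) (c : K) : Option K :=
  if c ∉ R ∧ last c ∈ D then some (col (π (last c))) else none

variable {col : V → K} {last : K → V} (hl : ∀ c, col (last c) = c)

theorem last_inj (hl : ∀ c, col (last c) = c) {c d : K} (h : last c = last d) : c = d := by
  rw [← hl c, h, hl]

theorem pf_congr {π π' : Equiv.Perm V} {R : Finset K} {D : Finset V}
    (h : ∀ x ∈ D, π x = π' x) : pf col last π R D = pf col last π' R D := by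
  funext c
  unfold pf
  split_ifs with hc
  · rw [h _ hc.2]
  · rfl

theorem Acy.mono_pf {π : Equiv.Perm V} {R : Finset K} {D E : Finset V} (hDE : D ⊆ E)
    (h : Acy (pf col last π R E)) : Acy (pf col last π R D) := by
  obtain ⟨h, hh⟩ := h
  refine ⟨h, fun z e hz => hh z e ?_⟩
  unfold pf at hz ⊢
  split_ifs at hz with h1
  rw [if_pos ⟨h1.1, hDE h1.2⟩, hz]

/-- new reference permutation sending `x` to `y` -/
def ref (π : Equiv.Perm V) (x y : V) : Equiv.Perm V := π * Equiv.swap x (π.symm y)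

theorem ref_apply (π : Equiv.Perm V) (x y : V) : ref π x y x = y := by
  simp [ref]

theorem ref_of_mem {π : Equiv.Perm V} {D : Finset V} {x y : V} (hx : x ∉ D) (hy : π.symm y ∉ D)
    {z : V} (hz : z ∈ D) : ref π x y z = π z := by
  have h1 : z ≠ x := by rintro rfl; exact hx hz
  have h2 : z ≠ π.symm y := by rintro rfl; exact hy hz
  simp [ref, Equiv.swap_apply_of_ne_of_ne h1 h2]

theorem ref_symm {π : Equiv.Perm V} {D : Finset V} {x y : V} (hx : x ∉ D) (hy : π.symm y ∉ D)
    (z : V) : (ref π x y).symm z ∉ insert x D ↔ π.symm z ∉ D ∧ z ≠ y := by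
  have h0 : (ref π x y).symm z = Equiv.swap x (π.symm y) (π.symm z) := by
    rw [Equiv.symm_apply_eq]
    simp [ref]
  rw [h0]
  by_cases hzy : z = y
  · subst hzy
    simp
  · have h2 : π.symm z ≠ π.symm y := by simpa using hzy
    by_cases h1 : π.symm z = x
    · simp [h1, hx, hzy]
      rw [← h1] 
      exact ⟨fun h => h2 h.symm, hy⟩
    · simp [Equiv.swap_apply_of_ne_of_ne h1 h2, h1, hzy]

theorem ref_agree {π0 π : Equiv.Perm V} {D : Finset V} {x y : V} (hx : x ∉ D)
    (hy : π0.symm y ∉ D) :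
    (∀ z ∈ insert x D, π z = ref π0 x y z) ↔ (∀ z ∈ D, π z = π0 z) ∧ π x = y := by
  rw [Finset.forall_mem_insert, ref_apply, and_comm]
  refine and_congr_left fun _ => forall₂_congr fun z hz => ?_
  rw [ref_of_mem hx hy hz]

theorem pf_ref (hl : ∀ c, col (last c) = c) {π : Equiv.Perm V} {R : Finset K} {D : Finset V}
    {c : K} {y : V} (hc : c ∉ R)
    (hx : last c ∉ D) (hy : π.symm y ∉ D) :
    pf col last (ref π (last c) y) R (insert (last c) D) =
      Function.update (pf col last π R D) c (some (col y)) := by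
  funext d
  by_cases hd : d = c
  · subst hd
    simp [pf, hc, ref_apply]
  · rw [Function.update_of_ne hd]
    have : last d ≠ last c := fun h => hd (last_inj hl h)
    unfold pf
    by_cases h : d ∉ R ∧ last d ∈ D
    · rw [if_pos h, if_pos ⟨h.1, by simp [h.2]⟩, ref_of_mem hx hy h.2]
    · rw [if_neg h, if_neg (by simpa [this] using h)]

theorem pf_none_of_not_mem {π : Equiv.Perm V} {R : Finset K} {D : Finset V}
    {c : K} (hx : last c ∉ D) : pf col last π R D c = none := by
  simp [pf, hx]

theorem card_agree (π0 : Equiv.Perm V) (D : Finset V) :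
    (univ.filter fun π : Equiv.Perm V => ∀ x ∈ D, π x = π0 x).card = (Dᶜ.card).factorial := by
  have e1 : {π : Equiv.Perm V // ∀ x ∈ D, π x = π0 x} ≃
      {σ : Equiv.Perm V // ∀ a, ¬ (a ∉ D) → σ a = a} :=
    { toFun := fun π => ⟨π0⁻¹ * π.1, fun a ha => by
        simp [π.2 a (not_not.1 ha)]⟩
      invFun := fun σ => ⟨π0 * σ.1, fun a ha => by
        simp [σ.2 a (not_not.2 ha)]⟩
      left_inv := fun π => by simp
      right_inv := fun σ => by simp }
  rw [← Fintype.card_subtype,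
    Fintype.card_congr (e1.trans (Equiv.Perm.subtypeEquivSubtypePerm (fun a => a ∉ D)).symm),
    Fintype.card_perm]
  congr 1
  rw [Fintype.card_subtype]
  congr 1
  ext; simp

theorem card_out (π : Equiv.Perm V) (D : Finset V) :
    (univ.filter fun y : V => π.symm y ∉ D).card = Dᶜ.card := by
  refine Finset.card_bij (fun y _ => π.symm y) ?_ ?_ ?_
  · simp
  · simp
  · intro b hb
    exact ⟨π b, by simpa using hb, by simp⟩

end Gen

section Gen
open Finset
open scoped Classical
set_option linter.unusedSectionVars false

variable {V K : Type} [Fintype V] [Fintype K] [DecidableEq V] [DecidableEq K]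
variable {col : V → K} {last : K → V}

theorem rho_reveal {π : Equiv.Perm V} {R : Finset K} {D : Finset V} {t : K → K}
    {c : K} {y : V} (hc : c ∉ R) (hx : last c ∉ D) (hy : π.symm y ∉ D) :
    (t (col y) ∈ R →
      (univ.filter fun y' : V => (ref π (last c) y).symm y' ∉ insert (last c) D ∧
        (if t (col y') = c then t (col y) else t (col y')) ∈ R).card + 1 =
      (univ.filter fun y' : V => π.symm y' ∉ D ∧ t (col y') ∈ R).card +
      (univ.filter fun y' : V => π.symm y' ∉ D ∧ t (col y') = c).card) ∧
    (t (col y) ∉ R →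
      (univ.filter fun y' : V => (ref π (last c) y).symm y' ∉ insert (last c) D ∧
        (if t (col y') = c then t (col y) else t (col y')) ∈ R).card =
      (univ.filter fun y' : V => π.symm y' ∉ D ∧ t (col y') ∈ R).card) := by
  simp only [ref_symm hx hy]
  constructor
  · intro hyR
    rw [← Finset.card_union_of_disjoint]
    · have : (univ.filter fun y' : V => (π.symm y' ∉ D ∧ y' ≠ y) ∧
        (if t (col y') = c then t (col y) else t (col y')) ∈ R) =
        ((univ.filter fun y' : V => π.symm y' ∉ D ∧ t (col y') ∈ R) ∪
      (univ.filter fun y' : V => π.symm y' ∉ D ∧ t (col y') = c)).erase y := by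
        ext y'
        simp only [mem_filter, mem_univ, true_and, mem_erase, mem_union]
        split_ifs with h
        · simp [h, hyR, hc]; tauto
        · simp [h]; tauto
      rw [this, Finset.card_erase_add_one]
      simp [hy, hyR]
    · rw [Finset.disjoint_left]
      intro a ha hb
      simp at ha hb
      rw [hb.2] at ha
      exact hc ha.2
  · intro hyR
    congr 1
    ext y'
    simp only [mem_filter, mem_univ, true_and]
    split_ifs with h
    · simp [h, hyR, hc]
    · constructor
      · tauto
      · rintro ⟨h1, h2⟩
        refine ⟨⟨h1, ?_⟩, h2⟩
        rintro rfl
        exact hyR h2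

theorem card_fiber {π0 : Equiv.Perm V} {D : Finset V} {x : V}
    (hx : x ∉ D) (P : Equiv.Perm V → Prop) :
    (univ.filter fun π : Equiv.Perm V => (∀ x ∈ D, π x = π0 x) ∧ P π).card =
    ∑ y ∈ univ.filter (fun y : V => π0.symm y ∉ D),
      (univ.filter fun π : Equiv.Perm V =>
        (∀ z ∈ insert x D, π z = ref π0 x y z) ∧ P π).card := by
  rw [Finset.card_eq_sum_card_fiberwise (f := fun π => π x)
    (t := univ.filter (fun y : V => π0.symm y ∉ D))]
  · refine Finset.sum_congr rfl fun y hy => ?_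
    simp only [mem_filter, mem_univ, true_and] at hy
    congr 1
    ext π
    simp only [mem_filter, mem_univ, true_and]
    rw [ref_agree hx hy]
    tauto
  · intro π hπ
    simp only [coe_filter, mem_univ, true_and, Set.mem_ofPred_eq] at hπ ⊢
    intro hmem
    have := hπ.1 _ hmem
    simp at this
    exact hx (this ▸ hmem)

theorem count_zero {π0 : Equiv.Perm V} {R : Finset K} {D : Finset V}
    (h : ¬ Acy (pf col last π0 R D)) (P : Equiv.Perm V → Prop) :
    (univ.filter fun π : Equiv.Perm V => (∀ x ∈ D, π x = π0 x) ∧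
      Acy (pf col last π R univ) ∧ P π).card = 0 := by
  rw [Finset.card_eq_zero, Finset.filter_eq_empty_iff]
  rintro π - ⟨h1, h2, -⟩
  have h3 := h2.mono_pf (Finset.subset_univ D)
  rw [pf_congr h1] at h3
  exact h h3

theorem count_done {π0 : Equiv.Perm V} {R : Finset K} {D : Finset V}
    (hacy : Acy (pf col last π0 R D)) (hn : ∀ c, c ∉ R → last c ∈ D) :
    (univ.filter fun π : Equiv.Perm V => (∀ x ∈ D, π x = π0 x) ∧
      Acy (pf col last π R univ)).card = (Dᶜ.card).factorial := by
  rw [← card_agree π0 D]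
  congr 1
  ext π
  simp only [mem_filter, mem_univ, true_and, and_iff_left_iff_imp]
  intro h
  rw [← pf_congr h] at hacy
  convert hacy using 1
  funext c
  by_cases hc : c ∈ R
  · simp [pf, hc]
  · simp [pf, hc, hn c hc]

theorem term_cases {π0 : Equiv.Perm V} {R : Finset K} {D : Finset V} {t : K → K}
    (hacy : Acy (pf col last π0 R D)) (ht : IsTerm (pf col last π0 R D) t) (z : K) :
    t z ∉ R → last (t z) ∉ D := by
  intro h1 h2
  have := hacy.term_none ht z
  simp [pf, h1, h2] at this

theorem count_forest (hl : ∀ c, col (last c) = c) (R : Finset K) (n : ℕ) :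
    ∀ (π0 : Equiv.Perm V) (D : Finset V) (t : K → K),
    (univ.filter fun c : K => c ∉ R ∧ last c ∉ D).card = n →
    Acy (pf col last π0 R D) → IsTerm (pf col last π0 R D) t → 0 < Dᶜ.card →
    (univ.filter fun π : Equiv.Perm V => (∀ x ∈ D, π x = π0 x) ∧
      Acy (pf col last π R univ)).card =
    (Dᶜ.card - 1).factorial *
      (univ.filter fun y : V => π0.symm y ∉ D ∧ t (col y) ∈ R).card := by
  induction n with
  | zero =>
    intro π0 D t hn hacy ht hm
    have hn' : ∀ c, c ∉ R → last c ∈ D := by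
      intro c hc
      rw [Finset.card_eq_zero, Finset.filter_eq_empty_iff] at hn
      have := hn (mem_univ c)
      tauto
    rw [count_done hacy hn']
    have : (univ.filter fun y : V => π0.symm y ∉ D ∧ t (col y) ∈ R) =
        univ.filter fun y : V => π0.symm y ∉ D := by
      ext y
      simp only [mem_filter, mem_univ, true_and, and_iff_left_iff_imp]
      intro _
      by_contra h
      exact term_cases hacy ht _ h (hn' _ h)
    rw [this, card_out, mul_comm, Nat.mul_factorial_pred hm.ne']
  | succ n ih =>
    intro π0 D t hn hacy ht hm
    have hpos : 0 < (univ.filter fun c : K => c ∉ R ∧ last c ∉ D).card := by omega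
    obtain ⟨c, hc⟩ := Finset.card_pos.1 hpos
    simp only [mem_filter, mem_univ, true_and] at hc
    obtain ⟨hcR, hx⟩ := hc
    rw [card_fiber hx (fun π => Acy (pf col last π R univ))]
    have hfc : pf col last π0 R D c = none := pf_none_of_not_mem hx
    have hcard : (insert (last c) D)ᶜ.card = Dᶜ.card - 1 := by
      rw [Finset.compl_insert, Finset.card_erase_of_mem (by simpa using hx)]
    have hn' : (univ.filter fun d : K => d ∉ R ∧ last d ∉ insert (last c) D).card = n := by
      have : (univ.filter fun d : K => d ∉ R ∧ last d ∉ insert (last c) D) =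
          (univ.filter fun c : K => c ∉ R ∧ last c ∉ D).erase c := by
        ext d
        simp only [mem_filter, mem_univ, true_and, mem_insert, mem_erase, not_or]
        constructor
        · rintro ⟨h1, h2, h3⟩
          exact ⟨fun h => h2 (h ▸ rfl), h1, h3⟩
        · rintro ⟨h1, h2, h3⟩
          exact ⟨h2, fun h => h1 (last_inj hl h), h3⟩
      rw [this, Finset.card_erase_of_mem (by simp [hcR, hx]), hn]
      rfl
    set ρ := (univ.filter fun y : V => π0.symm y ∉ D ∧ t (col y) ∈ R).card with hρ
    set lam := (univ.filter fun y : V => π0.symm y ∉ D ∧ t (col y) = c).card with hlam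
    set Y := univ.filter (fun y : V => π0.symm y ∉ D) with hY
    have hYc : Y.card = Dᶜ.card := card_out π0 D
    have hρ' : (Y.filter fun y => t (col y) ∈ R).card = ρ := by rw [hρ, hY, Finset.filter_filter]
    have hlam' : (Y.filter fun y => t (col y) = c).card = lam := by
      rw [hlam, hY, Finset.filter_filter]
    have hzero : ∀ y ∈ Y, t (col y) = c → (univ.filter fun π : Equiv.Perm V =>
        (∀ z ∈ insert (last c) D, π z = ref π0 (last c) y z) ∧
          Acy (pf col last π R univ)).card = 0 := by
      intro y hy hyc
      have hy' : π0.symm y ∉ D := by simpa [hY] using hy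
      have := count_zero (col := col) (last := last) (R := R) (π0 := ref π0 (last c) y)
        (D := insert (last c) D)
        (by rw [pf_ref hl hcR hx hy']; exact not_acy_update hacy ht hfc hyc) (fun _ => True)
      simpa using this
    by_cases hm1 : Dᶜ.card = 1
    · have hn0 : n = 0 := by
        have h1 : (univ.filter fun c : K => c ∉ R ∧ last c ∉ D).card ≤ Dᶜ.card := by
          refine Finset.card_le_card_of_injOn last ?_ ?_
          · intro d hd; simp at hd ⊢; exact hd.2
          · intro a _ b _ hab; exact last_inj hl hab
        omega
      obtain ⟨y, hy⟩ := Finset.card_eq_one.1 (hYc.trans hm1)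
      have hyY : y ∈ Y := by simp [hy]
      have hy' : π0.symm y ∉ D := by simpa [hY] using hyY
      rw [← hρ', hm1, hy, Finset.sum_singleton, Finset.filter_singleton]
      by_cases hyc : t (col y) = c
      · rw [hzero y hyY hyc]
        simp [hyc, hcR]
      · have hR : t (col y) ∈ R := by
          by_contra h
          have h1 := term_cases hacy ht _ h
          have h2 : last (t (col y)) = last c := by
            obtain ⟨w, hw⟩ := Finset.card_eq_one.1 hm1
            have a1 : last (t (col y)) ∈ Dᶜ := by simpa using h1
            have a2 : last c ∈ Dᶜ := by simpa using hx
            rw [hw] at a1 a2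
            simp at a1 a2
            rw [a1, a2]
          exact hyc (last_inj hl h2)
        rw [count_done, hcard, hm1]
        · simp [hR]
        · rw [pf_ref hl hcR hx hy']
          exact hacy.update ht hfc hyc
        · intro d hd
          rw [hn0, Finset.card_eq_zero, Finset.filter_eq_empty_iff] at hn'
          have := hn' (mem_univ d)
          tauto
    · have step : ∀ y ∈ Y, ((univ.filter fun π : Equiv.Perm V =>
        (∀ z ∈ insert (last c) D, π z = ref π0 (last c) y z) ∧
          Acy (pf col last π R univ)).card : ℤ) =
          ((Dᶜ.card - 2).factorial : ℤ) * ((if t (col y) ∈ R then ((lam : ℤ) - 1) else 0) + ρ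
            - (if t (col y) = c then (ρ : ℤ) else 0)) := by
        intro y hy
        have hy' : π0.symm y ∉ D := by simpa [hY] using hy
        by_cases hyc : t (col y) = c
        · rw [hzero y hy hyc]
          simp [hyc, hcR]
        · have hrr := rho_reveal (col := col) (last := last) (t := t) hcR hx hy'
          rw [ih (ref π0 (last c) y) (insert (last c) D)
            (fun z => if t z = c then t (col y) else t z) hn'
            (by rw [pf_ref hl hcR hx hy']; exact hacy.update ht hfc hyc)
            (by rw [pf_ref hl hcR hx hy']; exact ht.update hfc hyc) (by omega), hcard]
          rw [show Dᶜ.card - 1 - 1 = Dᶜ.card - 2 by omega]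
          push_cast
          congr 1
          by_cases hyR : t (col y) ∈ R
          · have := hrr.1 hyR
            simp only [hyR, hyc, if_true, if_false]
            rw [← hρ, ← hlam] at this
            zify at this
            linarith
          · have := hrr.2 hyR
            simp only [hyR, hyc, if_false]
            rw [← hρ] at this
            zify at this
            linarith
      zify
      rw [Finset.sum_congr rfl step, ← Finset.mul_sum, Finset.sum_sub_distrib,
        Finset.sum_add_distrib, ← Finset.sum_filter, ← Finset.sum_filter]
      simp only [Finset.sum_const, nsmul_eq_mul]
      rw [hρ', hlam', hYc]
      obtain ⟨m, hmm⟩ : ∃ m, Dᶜ.card = m + 2 := ⟨Dᶜ.card - 2, by omega⟩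
      rw [hmm, show m + 2 - 1 = m + 1 by omega, show m + 2 - 2 = m by omega, Nat.factorial_succ]
      push_cast
      ring

end Gen

section Gen
open Finset
open scoped Classical
set_option linter.unusedSectionVars false

variable {V K : Type} [Fintype V] [Fintype K] [DecidableEq V] [DecidableEq K]
variable {col : V → K} {last : K → V}

/-- next column along the reversed chain -/
noncomputable def nxt (col : V → K) (last : K → V) (π : Equiv.Perm V) (R : Finset K) (d : K) :
    Option K :=
  if last (col (π.symm (last d))) = π.symm (last d) ∧ col (π.symm (last d)) ∉ R then
    some (col (π.symm (last d))) else none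

theorem nxt_eq_some (hl : ∀ c, col (last c) = c) {π : Equiv.Perm V} {R : Finset K} {c d : K} :
    nxt col last π R d = some c ↔ c ∉ R ∧ π (last c) = last d := by
  unfold nxt
  constructor
  · intro h
    split_ifs at h with h1
    simp at h
    subst h
    refine ⟨h1.2, ?_⟩
    rw [h1.1]; simp
  · rintro ⟨h1, h2⟩
    have : π.symm (last d) = last c := by rw [Equiv.symm_apply_eq, h2]
    simp [this, hl, h1]

noncomputable def chain (col : V → K) (last : K → V) (π : Equiv.Perm V) (R : Finset K) :
    ℕ → K → Prop
  | 0, _ => True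
  | T + 1, d => ∃ c, nxt col last π R d = some c ∧ chain col last π R T c

theorem card_fiber_chain (hl : ∀ c, col (last c) = c) {π0 : Equiv.Perm V} {D : Finset V}
    {R : Finset K} {cur : K} (hcur : π0.symm (last cur) ∉ D) (P : Equiv.Perm V → Prop) (T : ℕ) :
    (univ.filter fun π : Equiv.Perm V => (∀ x ∈ D, π x = π0 x) ∧ P π ∧
      chain col last π R (T + 1) cur).card =
    ∑ c ∈ univ.filter (fun c : K => c ∉ R ∧ last c ∉ D),
      (univ.filter fun π : Equiv.Perm V =>
        (∀ z ∈ insert (last c) D, π z = ref π0 (last c) (last cur) z) ∧ P π ∧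
        chain col last π R T c).card := by
  rw [← Finset.card_biUnion]
  · congr 1
    ext π
    simp only [mem_filter, mem_univ, true_and, mem_biUnion]
    rw [chain]
    constructor
    · rintro ⟨h1, h2, c, hc, h3⟩
      rw [nxt_eq_some hl] at hc
      have hcD : last c ∉ D := by
        intro h
        apply hcur
        rw [← hc.2, h1 _ h]
        simpa using h
      refine ⟨c, ⟨hc.1, hcD⟩, ?_, h2, h3⟩
      rw [ref_agree hcD hcur]
      exact ⟨h1, hc.2⟩
    · rintro ⟨c, ⟨hc, hcD⟩, h1, h2, h3⟩
      rw [ref_agree hcD hcur] at h1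
      exact ⟨h1.1, h2, c, (nxt_eq_some hl).2 ⟨hc, h1.2⟩, h3⟩
  · intro c hc d hd hcd
    simp at hc hd
    rw [Function.onFun, Finset.disjoint_left]
    intro π h1 h2
    simp only [mem_filter, mem_univ, true_and] at h1 h2
    have a1 := ((ref_agree hc.2 hcur).1 h1.1).2
    have a2 := ((ref_agree hd.2 hcur).1 h2.1).2
    exact hcd (last_inj hl (π.injective (a1.trans a2.symm)))

theorem count_chain (hl : ∀ c, col (last c) = c) (R : Finset K) (T : ℕ) :
    ∀ (π0 : Equiv.Perm V) (D : Finset V) (t : K → K) (cur : K) (u m ρ : ℕ),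
    Acy (pf col last π0 R D) → IsTerm (pf col last π0 R D) t →
    π0.symm (last cur) ∉ D →
    (∀ c, c ∉ R → last c ∉ D → c ≠ t cur → π0.symm (last c) ∉ D) →
    (univ.filter fun c : K => c ∉ R ∧ last c ∉ D).card = u →
    Dᶜ.card = m →
    (univ.filter fun y : V => π0.symm y ∉ D ∧ t (col y) ∈ R).card = ρ →
    ((univ.filter fun π : Equiv.Perm V => (∀ x ∈ D, π x = π0 x) ∧
      Acy (pf col last π R univ) ∧ chain col last π R T cur).card : ℤ) =
    if t cur ∈ R then
      ((m - T - 1).factorial : ℤ) * ((u.descFactorial T : ℤ) * ((ρ : ℤ) - T) +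
        T * ((u - 1).descFactorial (T - 1) : ℤ) * ((m : ℤ) - ρ))
    else ((m - T - 1).factorial : ℤ) * ((u - 1).descFactorial T : ℤ) * ρ := by
  induction T with
  | zero =>
    intro π0 D t cur u m ρ hacy ht hcur hb hu hm hρ
    have hm0 : 0 < Dᶜ.card := Finset.card_pos.2 ⟨_, Finset.mem_compl.2 hcur⟩
    have := count_forest hl R u π0 D t hu hacy ht hm0
    simp only [chain, and_true]
    rw [this, hρ, hm]
    push_cast
    simp
  | succ T ih =>
    intro π0 D t cur u m ρ hacy ht hcur hb hu hm hρ
    rw [card_fiber_chain hl hcur (fun π => Acy (pf col last π R univ)) T]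
    set S := univ.filter (fun c : K => c ∉ R ∧ last c ∉ D) with hS
    set lam : K → ℕ := fun c => (univ.filter fun y : V => π0.symm y ∉ D ∧ t (col y) = c).card
      with hlam
    have hsumlam : (∑ c ∈ S, (lam c : ℤ)) = (m : ℤ) - ρ := by
      have h1 : (univ.filter fun y : V => π0.symm y ∉ D ∧ t (col y) ∉ R).card =
          ∑ c ∈ S, lam c := by
        rw [Finset.card_eq_sum_card_fiberwise (f := fun y => t (col y)) (t := S)]
        · refine Finset.sum_congr rfl fun c hc => ?_
          simp only [hS, mem_filter, mem_univ, true_and] at hc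
          rw [hlam, Finset.filter_filter]
          congr 1
          ext y
          simp only [mem_filter, mem_univ, true_and]
          constructor
          · rintro ⟨⟨a, b⟩, c⟩; exact ⟨a, c⟩
          · rintro ⟨a, rfl⟩; exact ⟨⟨a, hc.1⟩, rfl⟩
        · intro y hy
          simp only [coe_filter, mem_univ, true_and, Set.mem_ofPred_eq, hS] at hy ⊢
          exact ⟨hy.2, term_cases hacy ht _ hy.2⟩
      have h2 := Finset.card_filter_add_card_filter_not (s := univ.filter fun y : V => π0.symm y ∉ D)
        (fun y => t (col y) ∈ R)
      rw [Finset.filter_filter, Finset.filter_filter, hρ, h1, card_out, hm] at h2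
      zify at h2
      linarith
    have hzero : ∀ c ∈ S, c = t cur → (univ.filter fun π : Equiv.Perm V =>
        (∀ z ∈ insert (last c) D, π z = ref π0 (last c) (last cur) z) ∧
          Acy (pf col last π R univ) ∧ chain col last π R T c).card = 0 := by
      intro c hc hct
      simp only [hS, mem_filter, mem_univ, true_and] at hc
      apply count_zero
      rw [pf_ref hl hc.1 hc.2 hcur, hl]
      exact not_acy_update hacy ht (pf_none_of_not_mem hc.2) hct.symm
    have hcardS : ∀ c ∈ S,
        (univ.filter fun d : K => d ∉ R ∧ last d ∉ insert (last c) D).card = u - 1 := by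
      intro c hc
      have : (univ.filter fun d : K => d ∉ R ∧ last d ∉ insert (last c) D) = S.erase c := by
        ext d
        simp only [hS, mem_filter, mem_univ, true_and, mem_insert, mem_erase, not_or]
        constructor
        · rintro ⟨h1, h2, h3⟩
          exact ⟨fun h => h2 (h ▸ rfl), h1, h3⟩
        · rintro ⟨h1, h2, h3⟩
          exact ⟨h2, fun h => h1 (last_inj hl h), h3⟩
      rw [this, Finset.card_erase_of_mem hc, hu]
    have hm' : ∀ c ∈ S, (insert (last c) D)ᶜ.card = m - 1 := by
      intro c hc
      simp only [hS, mem_filter, mem_univ, true_and] at hc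
      rw [Finset.compl_insert, Finset.card_erase_of_mem (by simpa using hc.2), hm]
    have hm1 : 1 ≤ m := hm ▸ Finset.card_pos.2 ⟨_, Finset.mem_compl.2 hcur⟩
    have hIH : ∀ c ∈ S, c ≠ t cur → ∀ ρ' : ℕ, (univ.filter fun y' : V =>
        (ref π0 (last c) (last cur)).symm y' ∉ insert (last c) D ∧
        (if t (col y') = c then t cur else t (col y')) ∈ R).card = ρ' → _ :=
      fun c hc hct ρ' hρ' => by
        have hc' := hc
        simp only [hS, mem_filter, mem_univ, true_and] at hc'
        have htc : t c = c := (ht c).1 (pf_none_of_not_mem hc'.2)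
        have hfc : pf col last π0 R D c = none := pf_none_of_not_mem hc'.2
        exact ih (ref π0 (last c) (last cur)) (insert (last c) D)
          (fun z => if t z = c then t cur else t z) c (u - 1) (m - 1) ρ'
          (by rw [pf_ref hl hc'.1 hc'.2 hcur, hl]; exact hacy.update ht hfc (Ne.symm hct))
          (by rw [pf_ref hl hc'.1 hc'.2 hcur, hl]; exact ht.update hfc (Ne.symm hct))
          (by
            rw [ref_symm hc'.2 hcur]
            refine ⟨hb c hc'.1 hc'.2 hct, fun h => hct ?_⟩
            rw [← last_inj hl h, htc])
          (by
            intro d hd hdD hdt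
            simp only [htc, if_true] at hdt
            simp only [mem_insert, not_or] at hdD
            rw [ref_symm hc'.2 hcur]
            refine ⟨hb d hd hdD.2 hdt, fun h => hdt ?_⟩
            rw [← last_inj hl h, (ht d).1 (pf_none_of_not_mem hdD.2)])
          (hcardS c hc) (hm' c hc) hρ'
    by_cases hcR : t cur ∈ R
    · rw [if_pos hcR]
      have step : ∀ c ∈ S, ((univ.filter fun π : Equiv.Perm V =>
        (∀ z ∈ insert (last c) D, π z = ref π0 (last c) (last cur) z) ∧
          Acy (pf col last π R univ) ∧ chain col last π R T c).card : ℤ) =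
          ((m - (T + 1) - 1).factorial : ℤ) * (((u - 1).descFactorial T : ℤ) *
            ((ρ : ℤ) - 1 - T) + T * ((u - 2).descFactorial (T - 1) : ℤ) * ((m : ℤ) - ρ) +
            (((u - 1).descFactorial T : ℤ) - T * ((u - 2).descFactorial (T - 1) : ℤ)) * lam c) := by
        intro c hc
        have hc' := hc
        simp only [hS, mem_filter, mem_univ, true_and] at hc'
        have hct : c ≠ t cur := by rintro rfl; exact hc'.1 hcR
        have htc : t c = c := (ht c).1 (pf_none_of_not_mem hc'.2)
        have hrr := (rho_reveal (col := col) (last := last) (t := t) hc'.1 hc'.2 hcur).1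
          (by rw [hl]; exact hcR)
        rw [hl, hρ] at hrr
        rw [hIH c hc hct _ rfl, if_pos (by simp [htc, hcR])]
        rw [show m - 1 - T - 1 = m - (T + 1) - 1 by omega, show u - 1 - 1 = u - 2 by omega]
        zify at hrr
        have e1 : (((univ.filter fun y' : V =>
          (ref π0 (last c) (last cur)).symm y' ∉ insert (last c) D ∧
          (if t (col y') = c then t cur else t (col y')) ∈ R).card : ℕ) : ℤ) =
          (ρ : ℤ) + lam c - 1 := by
          rw [hlam]; linarith
        rw [e1]
        push_cast [hm1]
        ring
      push_cast
      rw [Finset.sum_congr rfl step, ← Finset.mul_sum, Finset.sum_add_distrib, ← Finset.mul_sum,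
        hsumlam, Finset.sum_const, hu, nsmul_eq_mul]
      congr 1
      rcases u with _ | u
      · have hSe : S = ∅ := Finset.card_eq_zero.1 hu
        rw [hSe, Finset.sum_empty] at hsumlam
        rw [← hsumlam]
        simp
      · rw [Nat.succ_descFactorial_succ]
        simp only [Nat.add_sub_cancel]
        rcases T with _ | T
        · push_cast; simp
        · rcases u with _ | u
          · simp
          · rw [show u + 1 + 1 - 2 = u by omega, Nat.succ_descFactorial_succ]
            push_cast
            ring
    · rw [if_neg hcR]
      have hmem : t cur ∈ S := by
        simp only [hS, mem_filter, mem_univ, true_and]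
        exact ⟨hcR, term_cases hacy ht _ hcR⟩
      have step : ∀ c ∈ S, ((univ.filter fun π : Equiv.Perm V =>
        (∀ z ∈ insert (last c) D, π z = ref π0 (last c) (last cur) z) ∧
          Acy (pf col last π R univ) ∧ chain col last π R T c).card : ℤ) =
          if c = t cur then 0 else
          ((m - (T + 1) - 1).factorial : ℤ) * ((u - 2).descFactorial T : ℤ) * ρ := by
        intro c hc
        by_cases hct : c = t cur
        · rw [hzero c hc hct, if_pos hct]; rfl
        have hc' := hc
        simp only [hS, mem_filter, mem_univ, true_and] at hc'
        have htc : t c = c := (ht c).1 (pf_none_of_not_mem hc'.2)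
        have hrr := (rho_reveal (col := col) (last := last) (t := t) hc'.1 hc'.2 hcur).2
          (by rw [hl]; exact hcR)
        rw [hl, hρ] at hrr
        rw [hIH c hc hct _ hrr, if_neg (by simp [htc, hcR]), if_neg hct]
        rw [show m - 1 - T - 1 = m - (T + 1) - 1 by omega, show u - 1 - 1 = u - 2 by omega]
      push_cast
      rw [Finset.sum_congr rfl step, ← Finset.add_sum_erase S _ hmem, if_pos rfl, zero_add,
        Finset.sum_congr rfl (fun c hc => if_neg (Finset.ne_of_mem_erase hc)), Finset.sum_const,
        Finset.card_erase_of_mem hmem, hu, nsmul_eq_mul]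
      have hu1 : 1 ≤ u := hu ▸ Finset.card_pos.2 ⟨_, hmem⟩
      obtain ⟨w, rfl⟩ : ∃ w, u = w + 1 := ⟨u - 1, by omega⟩
      simp only [Nat.add_sub_cancel]
      rcases w with _ | w
      · simp
      · rw [show w + 1 + 1 - 2 = w by omega, Nat.succ_descFactorial_succ]
        push_cast
        ring

end Gen

section Gen
open Finset
open scoped Classical
set_option linter.unusedSectionVars false

variable {V K : Type} [Fintype V] [Fintype K] [DecidableEq V] [DecidableEq K]
variable {col : V → K} {last : K → V}

theorem card_R_mem (E : Finset K) (z : K) (hz : z ∉ E) (j : ℕ) :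
    (univ.filter fun R' : Finset K => (R'.card = j + 1 ∧ Disjoint R' E) ∧ z ∈ R').card =
      (Fintype.card K - E.card - 1).choose j := by
  have h1 : (Eᶜ.erase z).card = Fintype.card K - E.card - 1 := by
    rw [Finset.card_erase_of_mem (by simpa using hz), Finset.card_compl]
  rw [← h1, ← Finset.card_powersetCard]
  symm
  refine Finset.card_bij (fun S _ => insert z S) ?_ ?_ ?_
  · intro S hS
    rw [mem_powersetCard] at hS
    have hzS : z ∉ S := fun h => by simpa using hS.1 h
    simp only [mem_filter, mem_univ, true_and, mem_insert_self, and_true]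
    rw [Finset.card_insert_of_notMem hzS, hS.2]
    refine ⟨rfl, ?_⟩
    rw [Finset.disjoint_insert_left]
    refine ⟨hz, Finset.disjoint_left.2 fun a ha => ?_⟩
    have := hS.1 ha
    simp at this
    exact this.2
  · intro S hS S' hS' h
    rw [mem_powersetCard] at hS hS'
    have hzS : z ∉ S := fun h => by simpa using hS.1 h
    have hzS' : z ∉ S' := fun h => by simpa using hS'.1 h
    rw [← Finset.erase_insert hzS, ← Finset.erase_insert hzS', h]
  · intro R' hR'
    simp only [mem_filter, mem_univ, true_and] at hR'
    refine ⟨R'.erase z, ?_, Finset.insert_erase hR'.2⟩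
    rw [mem_powersetCard, Finset.card_erase_of_mem hR'.2, hR'.1.1]
    refine ⟨fun a ha => ?_, rfl⟩
    rw [mem_erase] at ha ⊢
    exact ⟨ha.1, by simpa using Finset.disjoint_left.1 hR'.1.2 ha.2⟩

theorem count_hit (π : Equiv.Perm V) (R : Finset K) (h : K → ℕ)
    (hh : ∀ d c, nxt col last π R d = some c → h c < h d)
    (t : Finset K → K → K)
    (ht : ∀ R', IsTerm (fun c => if c ∈ R' then none else nxt col last π R c) (t R'))
    (j n : ℕ) : ∀ (z : K) (E : Finset K), h z = n → (∀ w ∈ E, h z < h w) →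
    (univ.filter fun R' : Finset K => (R'.card = j + 1 ∧ Disjoint R' E) ∧ t R' z ∈ R').card =
      ∑ T ∈ range (Fintype.card K - E.card),
        if chain col last π R T z then (Fintype.card K - E.card - 1 - T).choose j else 0 := by
  induction n using Nat.strong_induction_on with
  | _ n ih =>
    intro z E hz hE
    have hzE : z ∉ E := fun h => lt_irrefl _ (hE z h)
    have hlt : E.card < Fintype.card K := Finset.card_lt_univ_of_notMem hzE
    obtain ⟨q, hq⟩ : ∃ q, Fintype.card K - E.card = q + 1 :=
      ⟨Fintype.card K - E.card - 1, by omega⟩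
    rw [hq, Finset.sum_range_succ']
    rw [← Finset.card_filter_add_card_filter_not (fun R' : Finset K => z ∈ R'),
      Finset.filter_filter, Finset.filter_filter, add_comm]
    congr 1
    · cases hn : nxt col last π R z with
      | none =>
        rw [Finset.sum_eq_zero]
        · rw [Finset.card_eq_zero, Finset.filter_eq_empty_iff]
          rintro R' - ⟨⟨_, h1⟩, h2⟩
          have := (ht R' z).1 (by simp [hn])
          rw [this] at h1
          exact h2 h1
        · intro T _
          rw [if_neg]
          rw [chain]
          simp [hn]
      | some z' =>
        have hlt' := hh z z' hn
        have := ih (h z') (hz ▸ hlt') z' (insert z E) rfl (by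
          intro w hw
          rw [mem_insert] at hw
          rcases hw with rfl | hw
          · exact hlt'
          · exact hlt'.trans (hE w hw))
        rw [Finset.card_insert_of_notMem hzE,
          show Fintype.card K - (E.card + 1) = q by omega] at this
        refine Eq.trans ?_ (this.trans ?_)
        · congr 1
          ext R'
          simp only [mem_filter, mem_univ, true_and, Finset.disjoint_insert_right]
          constructor
          · rintro ⟨⟨⟨a, b⟩, c⟩, d⟩
            refine ⟨⟨a, d, b⟩, ?_⟩
            rwa [(ht R' z).2 z' (by simp [hn, d])] at c
          · rintro ⟨⟨a, d, b⟩, c⟩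
            refine ⟨⟨⟨a, b⟩, ?_⟩, d⟩
            rwa [(ht R' z).2 z' (by simp [hn, d])]
        · refine Finset.sum_congr rfl fun T _ => ?_
          have e : chain col last π R (T + 1) z ↔ chain col last π R T z' := by
            rw [chain]; simp [hn]
          rw [show q + 1 - 1 - (T + 1) = q - 1 - T by omega]
          simp only [e]
    · rw [chain, if_pos trivial, Nat.sub_zero, ← hq, ← card_R_mem E z hzE j]
      congr 1
      ext R'
      simp only [mem_filter, mem_univ, true_and]
      constructor
      · rintro ⟨⟨a, b⟩, c⟩; exact ⟨a, c⟩
      · rintro ⟨a, c⟩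
        refine ⟨⟨a, ?_⟩, c⟩
        rwa [(ht R' z).1 (by simp [c])]

theorem acy_pf_empty (π0 : Equiv.Perm V) (R : Finset K) :
    Acy (pf col last π0 R ∅) ∧ IsTerm (pf col last π0 R ∅) id := by
  constructor
  · exact ⟨fun _ => 0, by simp [pf]⟩
  · intro z; simp [pf]

theorem count_N (hl : ∀ c, col (last c) = c) (R : Finset K) (T u g : ℕ)
    (hu : Rᶜ.card = u) (hg : (univ.filter fun y : V => col y ∈ R).card = g) :
    (∑ v ∈ (Rᶜ.image last)ᶜ, (((univ.filter fun π : Equiv.Perm V =>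
      Acy (pf col last π R univ) ∧ chain col last π R T (col v)).card : ℕ) : ℤ)) =
    ((Fintype.card V : ℤ) - u) * ((Fintype.card V - T - 1).factorial * (u.descFactorial T * g)) := by
  set s := Fintype.card V with hs
  have key : ∀ v, (((univ.filter fun π : Equiv.Perm V =>
      Acy (pf col last π R univ) ∧ chain col last π R T (col v)).card : ℕ) : ℤ) =
    if col v ∈ R then
      ((s - T - 1).factorial : ℤ) * ((u.descFactorial T : ℤ) * ((g : ℤ) - T) +
        T * ((u - 1).descFactorial (T - 1) : ℤ) * ((s : ℤ) - g))
    else ((s - T - 1).factorial : ℤ) * ((u - 1).descFactorial T : ℤ) * g := by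
    intro v
    have := count_chain hl R T 1 ∅ id (col v) u s g (acy_pf_empty 1 R).1 (acy_pf_empty 1 R).2
      (by simp) (by simp) (by
        rw [← hu]; congr 1; ext; simp) (by simp [hs]) (by simpa using hg)
    simpa using this
  rw [Finset.sum_congr rfl (fun v _ => key v), Finset.sum_ite, Finset.sum_const, Finset.sum_const]
  have hA : (Rᶜ.image last)ᶜ.card = s - u := by
    rw [Finset.card_compl, Finset.card_image_of_injective _ (fun a b h => last_inj hl h), hu]
  have hus : u ≤ s := by
    rw [← hu, ← Finset.card_image_of_injective Rᶜ (fun a b h => last_inj hl h)]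
    exact Finset.card_le_univ _
  have h1 : ((Rᶜ.image last)ᶜ.filter fun v => col v ∈ R).card = g := by
    rw [← hg]
    congr 1
    ext v
    simp only [mem_filter, mem_univ, true_and, mem_compl, mem_image, not_exists, not_and,
      and_iff_right_iff_imp]
    intro hv c hc h
    rw [← h, hl] at hv
    exact hc hv
  have h2 := Finset.card_filter_add_card_filter_not (s := (Rᶜ.image last)ᶜ) (fun v => col v ∈ R)
  rw [hA, h1] at h2
  have h3 : (((Rᶜ.image last)ᶜ.filter fun v => col v ∉ R).card : ℤ) = (s : ℤ) - u - g := by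
    zify [hus] at h2; linarith
  rw [nsmul_eq_mul, nsmul_eq_mul, h1, h3]
  have hug : u = 0 → (g : ℤ) = s := by
    intro h0
    rw [h0, Finset.card_eq_zero] at hu
    have hR : R = univ := by simpa using hu
    rw [← hg, hR]; simp [hs]
  rcases u with _ | u
  · rw [hug rfl]
    rcases T with _ | T <;> simp
  · rcases T with _ | T
    · simp; ring
    · simp only [Nat.add_sub_cancel]
      rw [Nat.succ_descFactorial_succ]
      have := Nat.succ_descFactorial_succ u T
      have h5 : ((u.descFactorial (T + 1) : ℕ) : ℤ) = ((u : ℤ) - T) * u.descFactorial T := by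
        rw [Nat.descFactorial_succ]
        rcases Nat.lt_or_ge u T with hlt | hge
        · rw [Nat.descFactorial_eq_zero_iff_lt.2 hlt]; simp
        · push_cast [hge]; ring
      rw [h5]
      push_cast
      ring

theorem nxt_height (hl : ∀ c, col (last c) = c) {π : Equiv.Perm V} {R : Finset K}
    (h : Acy (pf col last π R univ)) :
    ∃ h : K → ℕ, ∀ d c, nxt col last π R d = some c → h c < h d := by
  obtain ⟨h, hh⟩ := h
  refine ⟨fun c => univ.sup h - h c, fun d c hdc => ?_⟩
  rw [nxt_eq_some hl] at hdc
  have h1 := hh c d (by simp [pf, hdc.1, hdc.2, hl])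
  have h2 : h c ≤ univ.sup h := Finset.le_sup (mem_univ c)
  simp only
  omega

theorem pf_symm_image (hl : ∀ c, col (last c) = c) (π : Equiv.Perm V) (R R' : Finset K) :
    pf col last π.symm R' ((Rᶜ.image last).image π) =
      fun c => if c ∈ R' then none else nxt col last π R c := by
  funext c
  by_cases hc : c ∈ R'
  · simp [pf, hc]
  · simp only [hc, if_false]
    unfold pf nxt
    have : (c ∉ R' ∧ last c ∈ (Rᶜ.image last).image π) ↔
        (last (col (π.symm (last c))) = π.symm (last c) ∧ col (π.symm (last c)) ∉ R) := by
      simp only [hc, not_false_eq_true, true_and, mem_image, mem_compl]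
      constructor
      · rintro ⟨a, ⟨d, hd, rfl⟩, h⟩
        rw [← h]
        simp [hl, hd]
      · rintro ⟨h1, h2⟩
        exact ⟨π.symm (last c), ⟨_, h2, h1⟩, by simp⟩
    simp only [this]

theorem pf_univ_image (π : Equiv.Perm V) (R : Finset K) :
    pf col last π R univ = pf col last π R (Rᶜ.image last) := by
  funext c
  unfold pf
  by_cases hc : c ∈ R
  · simp [hc]
  · have : last c ∈ Rᶜ.image last := mem_image_of_mem _ (by simpa using hc)
    simp [hc, this]

theorem count_R (hl : ∀ c, col (last c) = c) (R : Finset K) (hR : R.Nonempty) (j u g : ℕ)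
    (hu : Rᶜ.card = u) (hg : (univ.filter fun y : V => col y ∈ R).card = g) :
    (∑ R' ∈ univ.filter (fun R' : Finset K => R'.card = j + 1),
      (((univ.filter fun π : Equiv.Perm V => Acy (pf col last π R univ) ∧
        Acy (pf col last π.symm R' univ)).card : ℕ) : ℤ)) =
    ∑ T ∈ range (Fintype.card K), ((Fintype.card K - 1 - T).choose j : ℤ) *
      ((Fintype.card V - T - 1).factorial * (u.descFactorial T * g)) := by
  set s := Fintype.card V with hs
  set A := Rᶜ.image last with hA
  have hAc : A.card = u := by
    rw [hA, Finset.card_image_of_injective _ (fun a b h => last_inj hl h), hu]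
  have hus : u ≤ s := by rw [← hAc]; exact Finset.card_le_univ _
  have hAm : Aᶜ.card = s - u := by rw [Finset.card_compl, hAc]
  have hm0 : 0 < Aᶜ.card := by
    obtain ⟨c, hc⟩ := hR
    refine Finset.card_pos.2 ⟨last c, ?_⟩
    simp only [hA, mem_compl, mem_image, not_exists, not_and]
    intro d hd h
    exact hd (last_inj hl h ▸ hc)
  set m := Aᶜ.card with hm
  set F := univ.filter fun π : Equiv.Perm V => Acy (pf col last π R univ) with hF
  have hFagree : ∀ π π' : Equiv.Perm V, (∀ x ∈ A, π x = π' x) →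
      (Acy (pf col last π R univ) ↔ Acy (pf col last π' R univ)) := by
    intro π π' h
    rw [pf_univ_image, pf_univ_image π', pf_congr h]
  -- double counting
  have dc : ∀ R' : Finset K, m.factorial * (univ.filter fun π : Equiv.Perm V =>
      Acy (pf col last π R univ) ∧ Acy (pf col last π.symm R' univ)).card =
      ∑ π0 ∈ F, (univ.filter fun π : Equiv.Perm V => (∀ x ∈ A, π x = π0 x) ∧
        Acy (pf col last π.symm R' univ)).card := by
    intro R'
    have e1 : ∀ π0 ∈ F, (univ.filter fun π : Equiv.Perm V => (∀ x ∈ A, π x = π0 x) ∧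
        Acy (pf col last π.symm R' univ)).card =
        ∑ π ∈ univ.filter (fun π : Equiv.Perm V =>
      Acy (pf col last π R univ) ∧ Acy (pf col last π.symm R' univ)),
        if (∀ x ∈ A, π x = π0 x) then 1 else 0 := by
      intro π0 h0
      rw [← Finset.card_filter, Finset.filter_filter]
      congr 1
      ext π
      simp only [mem_filter, mem_univ, true_and, hF] at h0 ⊢
      constructor
      · rintro ⟨a, b⟩; exact ⟨⟨(hFagree _ _ a).2 h0, b⟩, a⟩
      · rintro ⟨⟨_, b⟩, a⟩; exact ⟨a, b⟩
    rw [Finset.sum_congr rfl e1, Finset.sum_comm, mul_comm, ← smul_eq_mul, ← Finset.sum_const]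
    refine Finset.sum_congr rfl fun π hπ => ?_
    simp only [mem_filter, mem_univ, true_and] at hπ
    rw [← Finset.card_filter, hF, Finset.filter_filter, ← card_agree π A]
    congr 1
    ext π0
    simp only [mem_filter, mem_univ, true_and]
    constructor
    · intro a
      exact ⟨(hFagree _ _ a).2 hπ.1, fun x hx => (a x hx).symm⟩
    · rintro ⟨_, a⟩ x hx
      exact (a x hx).symm
  have fib : ∀ π0 ∈ F, ∀ t : Finset K → K → K,
      (∀ R', IsTerm (fun c => if c ∈ R' then none else nxt col last π0 R c) (t R')) →
      ∀ R' : Finset K, (univ.filter fun π : Equiv.Perm V => (∀ x ∈ A, π x = π0 x) ∧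
        Acy (pf col last π.symm R' univ)).card =
      (m - 1).factorial * (Aᶜ.filter fun v => t R' (col v) ∈ R').card := by
    intro π0 h0 t ht R'
    simp only [mem_filter, mem_univ, true_and, hF] at h0
    have hcm : (A.image π0)ᶜ.card = m := by
      rw [Finset.card_compl, Finset.card_image_of_injective _ π0.injective, hm, Finset.card_compl]
    have hacy : Acy (pf col last π0.symm R' (A.image π0)) := by
      rw [hA, pf_symm_image hl]
      obtain ⟨h, hh⟩ := nxt_height hl h0
      refine ⟨h, fun z e hz => hh z e ?_⟩
      simp only at hz
      split_ifs at hz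
      exact hz
    have := count_forest hl R' _ π0.symm (A.image π0) (t R') rfl hacy
      (by rw [hA, pf_symm_image hl]; exact ht R') (by rw [hcm]; exact hm0)
    rw [hcm] at this
    rw [show (Aᶜ.filter fun v => t R' (col v) ∈ R') = univ.filter fun y : V =>
        π0.symm.symm y ∉ A.image π0 ∧ t R' (col y) ∈ R' by
      ext v; simp, ← this]
    refine Finset.card_bij (fun π _ => π.symm) ?_ ?_ ?_
    · intro π hπ
      simp only [mem_filter, mem_univ, true_and, mem_image] at hπ ⊢
      refine ⟨?_, hπ.2⟩
      rintro x ⟨a, ha, rfl⟩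
      rw [Equiv.symm_apply_eq]
      simp [hπ.1 a ha]
    · intro π _ π' _ h
      exact Equiv.symm_bijective.injective h
    · intro τ hτ
      simp only [mem_filter, mem_univ, true_and] at hτ
      refine ⟨τ.symm, ?_, by simp⟩
      simp only [mem_filter, mem_univ, true_and, Equiv.symm_symm]
      refine ⟨fun x hx => ?_, hτ.2⟩
      rw [Equiv.symm_apply_eq, hτ.1 _ (mem_image_of_mem _ hx)]
      simp
  have per : ∀ π0 ∈ F, (∑ R' ∈ univ.filter (fun R' : Finset K => R'.card = j + 1),
      (univ.filter fun π : Equiv.Perm V => (∀ x ∈ A, π x = π0 x) ∧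
        Acy (pf col last π.symm R' univ)).card) =
      (m - 1).factorial * ∑ v ∈ Aᶜ, ∑ T ∈ range (Fintype.card K),
        if chain col last π0 R T (col v) then (Fintype.card K - 1 - T).choose j else 0 := by
    intro π0 h0
    have h0' := h0
    simp only [mem_filter, mem_univ, true_and, hF] at h0'
    obtain ⟨h, hh⟩ := nxt_height hl h0'
    have hex : ∀ R' : Finset K, ∃ t, IsTerm
        (fun c => if c ∈ R' then none else nxt col last π0 R c) t := by
      intro R'
      apply Acy.exists_term
      refine ⟨h, fun z e hz => hh z e ?_⟩
      simp only at hz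
      split_ifs at hz
      exact hz
    choose t ht using hex
    rw [Finset.sum_congr rfl (fun R' _ => fib π0 h0 t ht R'), ← Finset.mul_sum]
    congr 1
    simp only [Finset.card_filter]
    rw [Finset.sum_comm]
    refine Finset.sum_congr rfl fun v _ => ?_
    have := count_hit π0 R h hh t ht j _ (col v) ∅ rfl (by simp)
    simp only [Finset.card_empty, Nat.sub_zero, Finset.disjoint_empty_right, and_true] at this
    rw [← this, ← Finset.card_filter, Finset.filter_filter]
  have total : (m.factorial : ℤ) * (∑ R' ∈ univ.filter (fun R' : Finset K => R'.card = j + 1),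
      (((univ.filter fun π : Equiv.Perm V => Acy (pf col last π R univ) ∧
        Acy (pf col last π.symm R' univ)).card : ℕ) : ℤ)) =
      (m - 1).factorial * ∑ T ∈ range (Fintype.card K), ((Fintype.card K - 1 - T).choose j : ℤ) *
      (((s : ℤ) - u) * ((s - T - 1).factorial * (u.descFactorial T * g))) := by
    have e1 : m.factorial * (∑ R' ∈ univ.filter (fun R' : Finset K => R'.card = j + 1),
      (univ.filter fun π : Equiv.Perm V => Acy (pf col last π R univ) ∧
        Acy (pf col last π.symm R' univ)).card) = (m - 1).factorial *
        ∑ T ∈ range (Fintype.card K), (Fintype.card K - 1 - T).choose j *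
        ∑ v ∈ Aᶜ, (univ.filter fun π : Equiv.Perm V =>
      Acy (pf col last π R univ) ∧ chain col last π R T (col v)).card := by
      rw [Finset.mul_sum, Finset.sum_congr rfl (fun R' _ => dc R'), Finset.sum_comm,
        Finset.sum_congr rfl per, ← Finset.mul_sum]
      congr 1
      rw [Finset.sum_comm]
      simp only [Finset.mul_sum]
      rw [Finset.sum_comm]
      conv_rhs => rw [Finset.sum_comm]
      rw [Finset.sum_comm]
      refine Finset.sum_congr rfl fun v _ => ?_
      rw [Finset.sum_comm]
      refine Finset.sum_congr rfl fun T _ => ?_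
      rw [← Finset.sum_filter, Finset.sum_const, smul_eq_mul, mul_comm, hF, Finset.filter_filter]
    have e2 := congrArg (Nat.cast : ℕ → ℤ) e1
    push_cast at e2
    rw [e2]
    congr 1
    refine Finset.sum_congr rfl fun T _ => ?_
    rw [count_N hl R T u g hu hg]
  have hmz : (m : ℤ) = (s : ℤ) - u := by rw [hAm]; push_cast [hus]; ring
  have hf : (m.factorial : ℤ) = m * (m - 1).factorial := by
    exact_mod_cast (Nat.mul_factorial_pred hm0.ne').symm
  have hne : (m.factorial : ℤ) ≠ 0 := by exact_mod_cast Nat.factorial_ne_zero m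
  apply mul_left_cancel₀ hne
  rw [total, hf, mul_comm (m : ℤ), mul_assoc, Finset.mul_sum (range _) _ (m : ℤ)]
  congr 1
  refine Finset.sum_congr rfl fun T _ => ?_
  rw [← hmz]
  ring

end Gen

section Gen
open Finset
open scoped Classical
set_option linter.unusedSectionVars false

variable {V K : Type} [Fintype V] [Fintype K] [DecidableEq V] [DecidableEq K]
variable {col : V → K} {last : K → V}

theorem choose_desc (n i T : ℕ) :
    n.choose i * (n - i).descFactorial T = n.descFactorial T * (n - T).choose i := by
  rw [Nat.descFactorial_eq_factorial_mul_choose, Nat.descFactorial_eq_factorial_mul_choose]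
  have key : n.choose i * (n - i).choose T = n.choose T * (n - T).choose i := by
    rcases Nat.lt_or_ge n (T + i) with h | h
    · have h1 : n.choose i * (n - i).choose T = 0 := by
        rcases Nat.lt_or_ge n i with h' | h'
        · rw [Nat.choose_eq_zero_of_lt h', zero_mul]
        · rw [Nat.choose_eq_zero_of_lt (show n - i < T by omega), mul_zero]
      have h2 : n.choose T * (n - T).choose i = 0 := by
        rcases Nat.lt_or_ge n T with h' | h'
        · rw [Nat.choose_eq_zero_of_lt h', zero_mul]
        · rw [Nat.choose_eq_zero_of_lt (show n - T < i by omega), mul_zero]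
      rw [h1, h2]
    · have a := Nat.choose_mul (n := n) (k := T + i) (s := i) (by omega)
      have b := Nat.choose_mul (n := n) (k := T + i) (s := T) (by omega)
      rw [show T + i - i = T by omega] at a
      rw [show T + i - T = i by omega] at b
      rw [← a, ← b]
      congr 1
      exact (Nat.choose_symm_add).symm
  calc _ = T.factorial * (n.choose i * (n - i).choose T) := by ring
    _ = _ := by rw [key]; ring

theorem sum_g (i : ℕ) :
    (∑ R ∈ univ.filter (fun R : Finset K => R.card = i + 1),
      (univ.filter fun y : V => col y ∈ R).card) =
    Fintype.card V * (Fintype.card K - 1).choose i := by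
  simp only [Finset.card_filter]
  rw [Finset.sum_comm]
  have : ∀ y : V, (∑ R ∈ univ.filter (fun R : Finset K => R.card = i + 1),
      if col y ∈ R then 1 else 0) = (Fintype.card K - 1).choose i := by
    intro y
    have := card_R_mem (∅ : Finset K) (col y) (by simp) i
    simp only [Finset.card_empty, Nat.sub_zero, Finset.disjoint_empty_right, and_true] at this
    rw [← this, ← Finset.card_filter, Finset.filter_filter]
  simp only [this, Finset.sum_const, smul_eq_mul, Finset.card_univ]

theorem count_total (hl : ∀ c, col (last c) = c) (i j : ℕ) :
    (∑ R ∈ univ.filter (fun R : Finset K => R.card = i + 1),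
    ∑ R' ∈ univ.filter (fun R' : Finset K => R'.card = j + 1),
      (((univ.filter fun π : Equiv.Perm V => Acy (pf col last π R univ) ∧
        Acy (pf col last π.symm R' univ)).card : ℕ) : ℤ)) =
    ∑ T ∈ range (Fintype.card K), ((Fintype.card K - 1 - T).choose j : ℤ) *
      ((Fintype.card V - T - 1).factorial * (Fintype.card V *
        ((Fintype.card K - 1).descFactorial T * (Fintype.card K - 1 - T).choose i))) := by
  have h1 : ∀ R ∈ univ.filter (fun R : Finset K => R.card = i + 1),
     (∑ R' ∈ univ.filter (fun R' : Finset K => R'.card = j + 1),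
      (((univ.filter fun π : Equiv.Perm V => Acy (pf col last π R univ) ∧
        Acy (pf col last π.symm R' univ)).card : ℕ) : ℤ)) =
      ∑ T ∈ range (Fintype.card K), ((Fintype.card K - 1 - T).choose j : ℤ) *
      ((Fintype.card V - T - 1).factorial * ((Fintype.card K - 1 - i).descFactorial T *
        ((univ.filter fun y : V => col y ∈ R).card : ℕ))) := by
    intro R hR
    simp only [mem_filter, mem_univ, true_and] at hR
    exact count_R hl R (Finset.card_pos.1 (by omega)) j _ _
      (by rw [Finset.card_compl, hR]; omega) rfl
  rw [Finset.sum_congr rfl h1, Finset.sum_comm]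
  refine Finset.sum_congr rfl fun T _ => ?_
  rw [← Finset.mul_sum, ← Finset.mul_sum, ← Finset.mul_sum]
  congr 2
  have h2 := sum_g (col := col) i
  have h3 := choose_desc (Fintype.card K - 1) i T
  rw [← Nat.cast_sum, h2]
  exact_mod_cast (by rw [← h3]; ring :
    (Fintype.card K - 1 - i).descFactorial T * (Fintype.card V * (Fintype.card K - 1).choose i) =
    Fintype.card V * ((Fintype.card K - 1).descFactorial T * (Fintype.card K - 1 - T).choose i))

theorem acy_iff_trans (f : K → Option K) (r : K → K → Prop) (hr : ∀ c d, r c d ↔ f c = some d) :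
    Acy f ↔ ∀ c, ¬ Relation.TransGen r c c := by
  constructor
  · rintro ⟨h, hh⟩ c hc
    have : ∀ a b, Relation.TransGen r a b → h b < h a := by
      intro a b hab
      induction hab with
      | single h1 => exact hh _ _ ((hr _ _).1 h1)
      | tail _ h1 ih => exact (hh _ _ ((hr _ _).1 h1)).trans ih
    exact lt_irrefl _ (this c c hc)
  · intro H
    refine ⟨fun c => (univ.filter fun d => Relation.TransGen r c d).card, fun z e hz => ?_⟩
    have hze : r z e := (hr _ _).2 hz
    apply Finset.card_lt_card
    rw [Finset.ssubset_iff_of_subset]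
    · exact ⟨e, by simpa using Relation.TransGen.single hze, by simpa using H e⟩
    · intro d hd
      simp only [mem_filter, mem_univ, true_and] at hd ⊢
      exact Relation.TransGen.head hze hd

end Gen

section Gen
open Finset
open scoped Classical
set_option linter.unusedSectionVars false

variable {V K : Type} [Fintype V] [Fintype K] [DecidableEq V] [DecidableEq K]
variable {col : V → K} {last : K → V}

abbrev MS (s k : ℕ) : Type := {f : Fin s → Fin k // Monotone f ∧ Function.Surjective f}



theorem ms_zero {s k : ℕ} (f : Fin (s+1) → Fin (k+1)) (hm : Monotone f)
    (hs : Function.Surjective f) : f 0 = 0 := by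
  obtain ⟨i, hi⟩ := hs 0
  exact le_antisymm (hi ▸ hm (Fin.zero_le i)) (Fin.zero_le _)

theorem cons_mono {s k : ℕ} (g : Fin s → Fin (k+1)) (hg : Monotone g) :
    Monotone (Fin.cons 0 g : Fin (s+1) → Fin (k+1)) := by
  intro a b hab
  revert hab
  refine Fin.cases ?_ (fun a => ?_) a
  · intro _; simp
  · intro hab
    revert hab
    refine Fin.cases ?_ (fun b => ?_) b
    · intro h; exact absurd h (by simp)
    · intro h; simpa using hg (by simpa using h)

def msMap (s k : ℕ) : MS (s+1) (k+2) ⊕ MS (s+1) (k+1) → MS (s+2) (k+2)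
  | .inl g => ⟨Fin.cons 0 g.1, cons_mono _ g.2.1, fun d => by
      obtain ⟨i, hi⟩ := g.2.2 d
      exact ⟨i.succ, by simpa using hi⟩⟩
  | .inr g => ⟨Fin.cons 0 (fun i => (g.1 i).succ),
      cons_mono _ (fun a b hab => by simpa using g.2.1 hab), fun d => by
      refine Fin.cases ⟨0, by simp⟩ (fun d => ?_) d
      obtain ⟨i, hi⟩ := g.2.2 d
      exact ⟨i.succ, by simp [hi]⟩⟩

theorem msMap_bij (s k : ℕ) : Function.Bijective (msMap s k) := by
  constructor
  · rintro (⟨g, hg⟩ | ⟨g, hg⟩) (⟨h, hh⟩ | ⟨h, hh⟩) e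
    · replace e := congrArg Subtype.val e
      simp only [msMap] at e
      have := Fin.cons_injective2 e
      refine congrArg Sum.inl ?_
      exact Subtype.ext this.2
    · exfalso
      replace e := congrArg Subtype.val e
      simp only [msMap] at e
      have := (Fin.cons_injective2 e).2
      obtain ⟨i, hi⟩ := hg.2 0
      rw [this] at hi
      exact Fin.succ_ne_zero _ hi
    · exfalso
      replace e := congrArg Subtype.val e
      simp only [msMap] at e
      have := (Fin.cons_injective2 e).2
      obtain ⟨i, hi⟩ := hh.2 0
      rw [← this] at hi
      exact Fin.succ_ne_zero _ hi
    · replace e := congrArg Subtype.val e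
      simp only [msMap] at e
      have := (Fin.cons_injective2 e).2
      refine congrArg Sum.inr ?_
      refine Subtype.ext (funext fun i => ?_)
      exact Fin.succ_injective _ (congrFun this i)
  · rintro ⟨f, hm, hs⟩
    have h0 := ms_zero f hm hs
    by_cases h : ∃ i : Fin (s+1), f i.succ = 0
    · refine ⟨.inl ⟨fun i => f i.succ, fun a b hab => hm (by simpa using hab), fun d => ?_⟩, ?_⟩
      · obtain ⟨i, hi⟩ := hs d
        rcases Fin.eq_zero_or_eq_succ i with rfl | ⟨i, rfl⟩
        · obtain ⟨i', hi'⟩ := h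
          exact ⟨i', by rw [← hi, h0, ← hi']⟩
        · exact ⟨i, hi⟩
      · refine Subtype.ext (funext fun i => ?_)
        refine Fin.cases ?_ (fun i => ?_) i <;> simp [msMap, h0]
    · push Not at h
      refine ⟨.inr ⟨fun i => (f i.succ).pred (h i), fun a b hab => ?_, fun d => ?_⟩, ?_⟩
      · exact Fin.pred_le_pred_iff.2 (hm (by simpa using hab))
      · obtain ⟨i, hi⟩ := hs d.succ
        rcases Fin.eq_zero_or_eq_succ i with rfl | ⟨i, rfl⟩
        · rw [h0] at hi; exact absurd hi.symm (Fin.succ_ne_zero _)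
        · exact ⟨i, by simp [hi]⟩
      · refine Subtype.ext (funext fun i => ?_)
        refine Fin.cases ?_ (fun i => ?_) i <;> simp [msMap, h0]

theorem card_MS (s k : ℕ) : Fintype.card (MS (s+1) (k+1)) = s.choose k := by
  induction s generalizing k with
  | zero =>
    cases k with
    | zero =>
      rw [Nat.choose_self, Fintype.card_eq_one_iff]
      exact ⟨⟨fun i => i, fun a b h => h, fun d => ⟨d, rfl⟩⟩, fun f =>
        Subtype.ext (funext fun i => Fin.ext (by omega))⟩
    | succ k =>
      rw [Nat.choose_zero_succ, Fintype.card_eq_zero_iff]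
      refine ⟨fun f => ?_⟩
      have := Fintype.card_le_of_surjective _ f.2.2
      simp at this
  | succ s ih =>
    cases k with
    | zero =>
      rw [Nat.choose_zero_right, Fintype.card_eq_one_iff]
      exact ⟨⟨fun i => 0, fun a b h => le_rfl, fun d => ⟨0, Fin.ext (by omega)⟩⟩, fun f =>
        Subtype.ext (funext fun i => Fin.ext (by omega))⟩
    | succ k =>
      rw [← Fintype.card_of_bijective (msMap_bij s k), Fintype.card_sum, ih, ih,
        Nat.choose_succ_succ, add_comm]

end Gen

section Gen
open Finset
open scoped Classical
set_option linter.unusedSectionVars false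

variable {V K : Type} [Fintype V] [Fintype K] [DecidableEq V] [DecidableEq K]
variable {col : V → K} {last : K → V}

theorem mono_le {s k : ℕ} (f g : Fin s → Fin k) (hf : Monotone f) (hg : Monotone g)
    (h : ∀ c, (univ.filter fun i => f i = c).card = (univ.filter fun i => g i = c).card)
    (i : Fin s) : g i ≤ f i := by
  by_contra hlt
  push Not at hlt
  have key : ∀ f' : Fin s → Fin k, (univ.filter fun j => f' j ≤ f i).card =
      ∑ d ∈ univ.filter (fun d => d ≤ f i), (univ.filter fun j => f' j = d).card := by
    intro f'
    rw [Finset.card_eq_sum_card_fiberwise (f := f') (t := univ.filter (fun d => d ≤ f i))]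
    · refine Finset.sum_congr rfl fun d hd => ?_
      simp only [mem_filter, mem_univ, true_and] at hd
      congr 1
      ext j
      simp only [mem_filter, mem_univ, true_and]
      constructor
      · exact fun h => h.2
      · intro h; exact ⟨h ▸ hd, h⟩
    · intro j hj
      simpa using hj
  have e : (univ.filter fun j => f j ≤ f i).card = (univ.filter fun j => g j ≤ f i).card := by
    rw [key f, key g]
    exact Finset.sum_congr rfl fun d _ => h d
  have h1 : (univ.filter fun j => g j ≤ f i) ⊂ (univ.filter fun j => f j ≤ f i) := by
    have hsub : ∀ j, g j ≤ f i → j < i := fun j hj => by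
      by_contra hji
      push Not at hji
      exact absurd (hg hji) (not_le.2 (lt_of_le_of_lt hj hlt))
    rw [Finset.ssubset_iff_of_subset]
    · exact ⟨i, by simp, by simpa using hlt⟩
    · intro j hj
      simp only [mem_filter, mem_univ, true_and] at hj ⊢
      exact hf (hsub j hj).le
  exact absurd e (Finset.card_lt_card h1).ne'

theorem mono_eq {s k : ℕ} (f g : Fin s → Fin k) (hf : Monotone f) (hg : Monotone g)
    (h : ∀ c, (univ.filter fun i => f i = c).card = (univ.filter fun i => g i = c).card) :
    f = g :=
  funext fun i => le_antisymm (mono_le g f hg hf (fun c => (h c).symm) i) (mono_le f g hf hg h i)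

theorem pa_ext {p q s k : ℕ} (A B : PairedArray p q s k) (h1 : A.col1 = B.col1)
    (h2 : A.col2 = B.col2) (h3 : A.pairing = B.pairing) (h4 : A.marks1 = B.marks1)
    (h5 : A.marks2 = B.marks2) : A = B := by
  cases A; cases B
  simp only at h1 h2 h3 h4 h5
  subst h1 h2 h3 h4 h5
  rfl

def pairOf {s : ℕ} (π : Equiv.Perm (Fin s)) : Equiv.Perm (Fin s ⊕ Fin s) :=
  (Equiv.sumCongr π π.symm).trans (Equiv.sumComm _ _)

@[simp] theorem pairOf_inl {s : ℕ} (π : Equiv.Perm (Fin s)) (i : Fin s) :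
    pairOf π (Sum.inl i) = Sum.inr (π i) := rfl

@[simp] theorem pairOf_inr {s : ℕ} (π : Equiv.Perm (Fin s)) (i : Fin s) :
    pairOf π (Sum.inr i) = Sum.inl (π.symm i) := rfl

abbrev GoodR {s k : ℕ} (i j : ℕ) (col : Fin s → Fin k) 
    (x : (Finset (Fin k) × Finset (Fin k)) × Equiv.Perm (Fin s)) : Prop :=
  x.1.1.card = i + 1 ∧ x.1.2.card = j + 1 ∧
  (∀ c, ¬ Relation.TransGen (RowArc col col x.2 x.1.1) c c) ∧
  (∀ c, ¬ Relation.TransGen (RowArc col col x.2.symm x.1.2) c c)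

abbrev GT (s k i j : ℕ) : Type :=
  Σ col : MS s k, {x : (Finset (Fin k) × Finset (Fin k)) × Equiv.Perm (Fin s) // GoodR i j col.1 x}

def toPA {s k i j : ℕ} (x : GT s k i j) : {A : PairedArray s s s k //
    A.Vertical ∧ A.marks1.card = i + 1 ∧ A.marks2.card = j + 1 ∧ A.Full} :=
  ⟨{ col1 := x.1.1
     col2 := x.1.1
     mono1 := x.1.2.1
     mono2 := x.1.2.1
     pairing := pairOf x.2.1.2
     invol := by rintro (v | v) <;> simp
     fpf := by rintro (v | v) <;> simp
     marks1 := x.2.1.1.1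
     marks2 := x.2.1.1.2
     marks1_nonempty := Finset.card_pos.1 (by rw [x.2.2.1]; omega)
     marks2_nonempty := Finset.card_pos.1 (by rw [x.2.2.2.1]; omega)
     mixed_eq := by simp
     balance := by intro c; simp
     nonempty_cond := fun c _ _ => Or.inl (x.1.2.2 c)
     forest1_marks := fun c _ => x.1.2.2 c
     forest1_closed := fun _ d _ => x.1.2.2 d
     forest1_acyclic := fun c => x.2.2.2.2.1 c
     forest2_marks := fun c _ => x.1.2.2 c
     forest2_closed := fun _ d _ => x.1.2.2 d
     forest2_acyclic := fun c => x.2.2.2.2.2 c },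
   fun i => by simp, x.2.2.1, x.2.2.2.1, fun c => Or.inl (x.1.2.2 c)⟩

theorem toPA_bij (s k i j : ℕ) : Function.Bijective (toPA (s := s) (k := k) (i := i) (j := j)) := by
  constructor
  · rintro ⟨⟨f, hf⟩, ⟨⟨⟨R, R'⟩, π⟩, hx⟩⟩ ⟨⟨g, hg⟩, ⟨⟨⟨Q, Q'⟩, σ⟩, hy⟩⟩ e
    replace e := congrArg Subtype.val e
    have h1 : f = g := congrArg PairedArray.col1 e
    have h2 : R = Q := congrArg PairedArray.marks1 e
    have h3 : R' = Q' := congrArg PairedArray.marks2 e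
    have h4 : pairOf π = pairOf σ := congrArg PairedArray.pairing e
    have h5 : π = σ := by
      ext i
      have := congrArg (fun p => p (Sum.inl i)) h4
      simp only [pairOf_inl, Sum.inr.injEq] at this
      rw [this]
    subst h1 h2 h3 h5
    rfl
  · rintro ⟨A, hv, h1, h2, hfull⟩
    have ex : ∀ a : Fin s, ∃ b, A.pairing (Sum.inl a) = Sum.inr b := fun a =>
      Sum.isRight_iff.1 (hv a)
    choose p hp using ex
    have pinj : Function.Injective p := by
      intro a b hab
      have : A.pairing (Sum.inl a) = A.pairing (Sum.inl b) := by rw [hp, hp, hab]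
      exact Sum.inl_injective (A.pairing.injective this)
    let π : Equiv.Perm (Fin s) := Equiv.ofBijective p (Finite.injective_iff_bijective.1 pinj)
    have hπ : ∀ a, A.pairing (Sum.inl a) = Sum.inr (π a) := hp
    have hπ' : ∀ a, A.pairing (Sum.inr a) = Sum.inl (π.symm a) := by
      intro a
      have := A.invol (Sum.inl (π.symm a))
      rw [hπ, Equiv.apply_symm_apply] at this
      exact this
    have hpair : pairOf π = A.pairing := by
      ext v
      rcases v with v | v
      · rw [hπ, pairOf_inl]
      · rw [hπ', pairOf_inr]
    have hcol : A.col1 = A.col2 := by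
      refine mono_eq _ _ A.mono1 A.mono2 fun c => ?_
      have := A.balance c
      simp only [hπ, hπ', Sum.isRight_inr, Sum.isLeft_inl, and_true] at this
      convert this
    have hsurj : Function.Surjective A.col1 := by
      intro c
      rcases hfull c with h | h
      · exact h
      · rw [hcol]; exact h
    have a1 := A.forest1_acyclic
    have a2 := A.forest2_acyclic
    simp only [hπ, hπ'] at a1 a2
    rw [← hcol] at a1 a2
    refine ⟨⟨⟨A.col1, A.mono1, hsurj⟩, ⟨⟨⟨A.marks1, A.marks2⟩, π⟩, h1, h2, a1, a2⟩⟩, ?_⟩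
    refine Subtype.ext (pa_ext _ _ rfl hcol hpair rfl rfl)

theorem fvc_eq (s k i j : ℕ) : fullVertCount s k i j = ∑ col : MS s k,
    Fintype.card {x : (Finset (Fin k) × Finset (Fin k)) × Equiv.Perm (Fin s) //
      GoodR i j col.1 x} := by
  rw [fullVertCount, ← Nat.card_eq_of_bijective _ (toPA_bij s k i j), Nat.card_eq_fintype_card,
    Fintype.card_sigma]

theorem card_good {s k : ℕ} (i j : ℕ) (col : MS s k) :
    (Fintype.card {x : (Finset (Fin k) × Finset (Fin k)) × Equiv.Perm (Fin s) //
      GoodR i j col.1 x} : ℤ) =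
    ∑ T ∈ range k, ((k - 1 - T).choose j : ℤ) *
      ((s - T - 1).factorial * (s * ((k - 1).descFactorial T * (k - 1 - T).choose i))) := by
  obtain ⟨col, hm, hsurj⟩ := col
  have ex : ∀ c, ∃ l, col l = c ∧ ∀ l', col l' = c → l' ≤ l := by
    intro c
    obtain ⟨l, hl⟩ := hsurj c
    obtain ⟨m, hm, hmax⟩ := Finset.exists_max_image (univ.filter fun l => col l = c) id
      ⟨l, by simpa using hl⟩
    simp only [mem_filter, mem_univ, true_and, id] at hm hmax
    exact ⟨m, hm, hmax⟩
  choose last hl hlm using ex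
  have H := count_total (col := col) (last := last) hl i j
  simp only [Fintype.card_fin] at H
  rw [← H]
  have arc : ∀ (π : Equiv.Perm (Fin s)) (R : Finset (Fin k)),
      Acy (pf col last π R univ) ↔ ∀ c, ¬ Relation.TransGen (RowArc col col π R) c c := by
    intro π R
    refine acy_iff_trans _ _ fun c d => ?_
    simp only [pf, mem_univ, and_true, RowArc]
    constructor
    · rintro ⟨hc, m, h1, h2, h3⟩
      have : m = last c := le_antisymm (hlm c m h1) (h2 _ (hl c))
      subst this
      simp [hc, h3]
    · intro h
      by_cases hc : c ∈ R
      · simp [hc] at h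
      · simp only [hc, not_false_eq_true, if_true, Option.some.injEq] at h
        exact ⟨hc, last c, hl c, hlm c, h⟩
  simp only [arc]
  rw [Fintype.card_subtype, Finset.card_filter, Fintype.sum_prod_type, Fintype.sum_prod_type,
    Finset.sum_filter]
  push_cast
  refine Finset.sum_congr rfl fun R _ => ?_
  by_cases h1 : R.card = i + 1
  · rw [if_pos h1, Finset.sum_filter]
    refine Finset.sum_congr rfl fun R' _ => ?_
    by_cases h2 : R'.card = j + 1
    · rw [if_pos h2, Finset.card_filter]
      push_cast
      refine Finset.sum_congr rfl fun π _ => ?_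
      refine if_congr ?_ rfl rfl
      simp only [GoodR, h1, h2, true_and]
    · rw [if_neg h2]
      refine Finset.sum_eq_zero fun π _ => ?_
      rw [if_neg]
      exact fun h => h2 h.2.1
  · rw [if_neg h1]
    refine Finset.sum_eq_zero fun R' _ => Finset.sum_eq_zero fun π _ => ?_
    rw [if_neg]
    exact fun h => h1 h.1

theorem ichoose_nat (a b : ℕ) : ichoose (a : ℤ) (b : ℤ) = (a.choose b : ℤ) := by
  unfold ichoose
  split_ifs with h
  · simp
  · rw [Nat.choose_eq_zero_of_lt (by omega)]; simp

theorem arith (n m T : ℕ) (hT : T ≤ m) (hm : m ≤ n) :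
    n.choose m * ((n - T).factorial * m.descFactorial T) =
      n.factorial * (n - T).choose (m - T) := by
  have h1 := Nat.choose_mul_factorial_mul_factorial hm
  have h2 := Nat.choose_mul_factorial_mul_factorial (show m - T ≤ n - T by omega)
  have h3 := Nat.factorial_mul_descFactorial hT
  rw [show n - T - (m - T) = n - m by omega] at h2
  have p1 : 0 < (m - T).factorial * (n - m).factorial := by positivity
  apply Nat.eq_of_mul_eq_mul_right p1
  calc _ = (n.choose m * ((m - T).factorial * m.descFactorial T) * (n - m).factorial)
        * (n - T).factorial := by ring
    _ = n.factorial * ((n - T).choose (m - T) * (m - T).factorial * (n - m).factorial) := by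
        rw [h3, h1, h2]
    _ = _ := by ring

theorem fvc_main (s k i j : ℕ) (hs : 1 ≤ s) (hk : 1 ≤ k) :
    (fullVertCount s k i j : ℤ) =
      (Nat.factorial s : ℤ) *
        ∑ l ∈ Finset.range k,
          ichoose ((s : ℤ) - 1 - l) ((k : ℤ) - 1 - l) *
            ichoose ((k : ℤ) - 1 - l) (i : ℤ) * ichoose ((k : ℤ) - 1 - l) (j : ℤ) := by
  rw [fvc_eq]
  push_cast
  simp only [card_good]
  rw [Finset.sum_const, Finset.card_univ]
  obtain ⟨n, rfl⟩ : ∃ n, s = n + 1 := ⟨s - 1, by omega⟩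
  obtain ⟨m, rfl⟩ : ∃ m, k = m + 1 := ⟨k - 1, by omega⟩
  rw [card_MS, nsmul_eq_mul, Finset.mul_sum, Finset.mul_sum]
  refine Finset.sum_congr rfl fun T hT => ?_
  have hT : T ≤ m := by have := Finset.mem_range.1 hT; omega
  have e1 : (((m + 1 : ℕ) : ℤ) - 1 - T) = ((m - T : ℕ) : ℤ) := by omega
  rw [e1, ichoose_nat, ichoose_nat]
  rcases le_or_gt m n with h | h
  · have e2 : (((n + 1 : ℕ) : ℤ) - 1 - T) = ((n - T : ℕ) : ℤ) := by omega
    rw [e2, ichoose_nat, Nat.factorial_succ]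
    have := arith n m T hT h
    have h' : ((n.choose m : ℤ) * ((n - T).factorial * m.descFactorial T)) =
      n.factorial * (n - T).choose (m - T) := by exact_mod_cast this
    rw [show n + 1 - T - 1 = n - T by omega, show m + 1 - 1 - T = m - T by omega,
      show m + 1 - 1 = m by omega]
    rw [Nat.cast_mul]
    linear_combination ((m - T).choose j : ℤ) * ((m - T).choose i : ℤ) * ((n + 1 : ℕ) : ℤ) * h'
  · rw [Nat.choose_eq_zero_of_lt h]
    have : ichoose (((n + 1 : ℕ) : ℤ) - 1 - T) ((m - T : ℕ) : ℤ) = 0 := by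
      unfold ichoose
      rw [if_neg]
      omega
    rw [this]
    simp

end Gen

/-- Enumeration of full vertical paired arrays:
`f^{(s)}_{k,i,j} = s! ∑_{l=0}^{k-1} binom(s-1-l, k-1-l) binom(k-1-l, i) binom(k-1-l, j)`,
with the convention that binomial coefficients with negative lower entry or with lower
entry exceeding the upper entry are `0`. -/
theorem full_vertical_count (s k i j : ℕ) (hs : 1 ≤ s) (hk : 1 ≤ k) :
    (fullVertCount s k i j : ℤ) =
      (Nat.factorial s : ℤ) *
        ∑ l ∈ Finset.range k,
          ichoose ((s : ℤ) - 1 - l) ((k : ℤ) - 1 - l) *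
            ichoose ((k : ℤ) - 1 - l) (i : ℤ) * ichoose ((k : ℤ) - 1 - l) (j : ℤ) := by
  exact fvc_main s k i j hs hk
end

section
/- Let s ≥ 1, k ≥ 1, i ≥ 0, j ≥ 0 be integers. Then s! · Σ_{m=0}^{s} binom(s, m) · binom(s+i+j+m−k+1, s) · (s−m+k−1)! / [ (k−m−i−1)! (k−m−j−1)! (s+i+j+m−k+1)! ] = [(s+i)! (s+j)! / (s+i+j)!] · binom(s+i+j, k−1) · binom(k−1, i) · binom(k−1, j), where any summand in which k−m−i−1, k−m−j−1, or s+i+j+m−k+1 is negative is taken to be 0, and binom(a, b) = 0 whenever b < 0 or b > a. -/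
def psG (z : ℤ) : ℚ := if z < 0 then 0 else 1 / (Nat.factorial z.toNat : ℚ)

def psF (z : ℤ) : ℚ := (Nat.factorial z.toNat : ℚ)

lemma psG_neg {z : ℤ} (h : z < 0) : psG z = 0 := by simp [psG, h]

lemma psG_nat (a : ℕ) : psG (a : ℤ) = 1 / (Nat.factorial a : ℚ) := by
  simp [psG]

lemma psF_nat (a : ℕ) : psF (a : ℤ) = (Nat.factorial a : ℚ) := by
  simp [psF]

lemma psG_rec (z : ℤ) : psG (z - 1) = z * psG z := by
  rcases lt_trichotomy z 0 with h | h | h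
  · rw [psG_neg h, psG_neg (by omega)]; simp
  · subst h; rw [psG_neg (by omega)]; simp
  · obtain ⟨a, rfl⟩ : ∃ a : ℕ, z = (a : ℤ) + 1 := ⟨(z - 1).toNat, by omega⟩
    have h1 : ((a : ℤ) + 1 - 1) = (a : ℤ) := by ring
    have h2 : ((a : ℤ) + 1) = ((a + 1 : ℕ) : ℤ) := by push_cast; ring
    rw [h1, h2, psG_nat, psG_nat, Nat.factorial_succ]
    have : (Nat.factorial a : ℚ) ≠ 0 := by positivity
    push_cast
    field_simp

lemma psF_rec {z : ℤ} (h : 0 ≤ z) : psF (z + 1) = (z + 1) * psF z := by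
  obtain ⟨a, rfl⟩ := Int.eq_ofNat_of_zero_le h
  have h2 : ((a : ℤ) + 1) = ((a + 1 : ℕ) : ℤ) := by push_cast; ring
  rw [h2, psF_nat, psF_nat, Nat.factorial_succ]
  push_cast; ring

def psT (n i j s m : ℤ) : ℚ :=
  psF (n + s - m) * psG m * psG (s - m) * psG (n - m - i) * psG (n - m - j) * psG (m - (n - i - j))

def psC (n i j s m : ℤ) : ℚ :=
  -(psF (n + s + 1 - m) * psG (m - 1) * psG (s + 1 - m) * psG (n - m - i) * psG (n - m - j)
    * psG (m - (n - i - j) - 1))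

lemma psT_rec (n i j s m : ℤ) (hs : 0 ≤ s) :
    ((s + 1 - (n - i - j) : ℤ) : ℚ) * ((s + 1 : ℤ) : ℚ) * psT n i j (s + 1) m
      - ((s + 1 + i : ℤ) : ℚ) * ((s + 1 + j : ℤ) : ℚ) * psT n i j s m
      = psC n i j s (m + 1) - psC n i j s m := by
  have e1 : psG (s - m) = ((s + 1 - m : ℤ) : ℚ) * psG (s + 1 - m) := by
    rw [← psG_rec]; congr 1; ring
  have e2 : psG (n - (m + 1) - i) = ((n - m - i : ℤ) : ℚ) * psG (n - m - i) := by
    rw [← psG_rec]; congr 1; ring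
  have e3 : psG (n - (m + 1) - j) = ((n - m - j : ℤ) : ℚ) * psG (n - m - j) := by
    rw [← psG_rec]; congr 1; ring
  have e4 := psG_rec m
  have e5 := psG_rec (m - (n - i - j))
  have a1 : m + 1 - 1 = m := by ring
  have a2 : s + 1 - (m + 1) = s - m := by ring
  have a3 : m + 1 - (n - i - j) - 1 = m - (n - i - j) := by ring
  have a4 : n + s + 1 - (m + 1) = n + s - m := by ring
  have a5 : n + (s + 1) - m = n + s + 1 - m := by ring
  unfold psT psC
  rw [a1, a2, a3, a4, a5, e1, e2, e3, e4, e5]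
  by_cases h : 0 ≤ m ∧ 0 ≤ n - m - i ∧ 0 ≤ n - m - j ∧ 0 ≤ m - (n - i - j)
  · have e6 : psF (n + s + 1 - m) = ((n + s - m : ℤ) + 1 : ℚ) * psF (n + s - m) := by
      rw [← psF_rec (by omega)]; congr 1; ring
    rw [e6]
    push_cast
    ring
  · have h0 : psG m = 0 ∨ psG (n - m - i) = 0 ∨ psG (n - m - j) = 0 ∨ psG (m - (n - i - j)) = 0 := by
      by_contra hc
      apply h
      refine ⟨?_, ?_, ?_, ?_⟩ <;> by_contra hh <;> push Not at hh <;> have := psG_neg hh <;> tauto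
    rcases h0 with h0 | h0 | h0 | h0 <;> rw [h0] <;> ring

def psS (n i j s : ℕ) : ℚ := ∑ m ∈ Finset.range (n + 1), psT n i j s m

def psR (n i j s : ℕ) : ℚ :=
  psF ((s : ℤ) + i) * psF ((s : ℤ) + j) * psF n * psG i * psG j * psG ((s : ℤ) - (n - i - j)) *
    psG s * psG ((n : ℤ) - i) * psG ((n : ℤ) - j)

lemma psS_rec (n i j s : ℕ) :
    ((s + 1 - (n - i - j) : ℤ) : ℚ) * ((s + 1 : ℤ) : ℚ) * psS n i j (s + 1)
      = ((s + 1 + i : ℤ) : ℚ) * ((s + 1 + j : ℤ) : ℚ) * psS n i j s := by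
  rw [← sub_eq_zero]
  unfold psS
  rw [Finset.mul_sum, Finset.mul_sum, ← Finset.sum_sub_distrib]
  have : ∀ m ∈ Finset.range (n + 1), ((s + 1 - (n - i - j) : ℤ) : ℚ) * ((s + 1 : ℤ) : ℚ) *
      psT n i j ((s + 1 : ℕ) : ℤ) m
      - ((s + 1 + i : ℤ) : ℚ) * ((s + 1 + j : ℤ) : ℚ) * psT n i j s m
      = psC n i j s ((m + 1 : ℕ) : ℤ) - psC n i j s (m : ℕ) := by
    intro m _
    have := psT_rec n i j s m (by omega)
    push_cast at this ⊢
    exact this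
  rw [Finset.sum_congr rfl this, Finset.sum_range_sub (fun m : ℕ => psC n i j s m)]
  have h1 : psG ((n : ℤ) - ((n + 1 : ℕ) : ℤ) - i) = 0 := psG_neg (by push_cast; omega)
  have h2 : psG (((0 : ℕ) : ℤ) - 1) = 0 := psG_neg (by simp)
  unfold psC
  rw [h1, h2]
  ring

lemma psR_rec (n i j s : ℕ) :
    ((s + 1 - (n - i - j) : ℤ) : ℚ) * ((s + 1 : ℤ) : ℚ) * psR n i j (s + 1)
      = ((s + 1 + i : ℤ) : ℚ) * ((s + 1 + j : ℤ) : ℚ) * psR n i j s := by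
  have e1 := psG_rec (s + 1 : ℤ)
  have e2 := psG_rec (s + 1 - (n - i - j) : ℤ)
  have e3 := psF_rec (z := (s : ℤ) + i) (by omega)
  have e4 := psF_rec (z := (s : ℤ) + j) (by omega)
  have a1 : (s : ℤ) + 1 - 1 = s := by ring
  have a2 : (s : ℤ) + 1 - (n - i - j) - 1 = s - (n - i - j) := by ring
  have a3 : (s : ℤ) + 1 + i = s + i + 1 := by ring
  have a4 : (s : ℤ) + 1 + j = s + j + 1 := by ring
  rw [a1] at e1
  rw [a2] at e2
  unfold psR
  push_cast
  rw [e1, e2, a3, a4, e3, e4]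
  push_cast
  ring

lemma psF_mul_psG {z : ℤ} (h : 0 ≤ z) : psF z * psG z = 1 := by
  obtain ⟨a, rfl⟩ := Int.eq_ofNat_of_zero_le h
  rw [psF_nat, psG_nat]
  have : (Nat.factorial a : ℚ) ≠ 0 := by positivity
  field_simp

lemma psG_zero : psG 0 = 1 := by simp [psG]

lemma psS_eq (n i j s : ℕ) (hi : i ≤ n) (hj : j ≤ n) (h : n - i - j ≤ s) :
    psS n i j s = psR n i j s := by
  induction s, h using Nat.le_induction with
  | base =>
    unfold psS
    rw [Finset.sum_eq_single (n - i - j)]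
    · unfold psT psR
      rcases le_total n (i + j) with hc | hc
      · have a0 : n - i - j = 0 := by omega
        rw [a0]
        have b1 := psF_mul_psG (z := i) (by omega)
        have b2 := psF_mul_psG (z := j) (by omega)
        simp only [Nat.cast_zero, zero_add, sub_zero, add_zero, zero_sub, psG_zero, mul_one]
        linear_combination (-(psF n * psG (-(n - i - j : ℤ)) * psG ((n : ℤ) - i) * psG ((n : ℤ) - j))) * (psF j * psG j * b1 + b2)
      · have a0 : ((n - i - j : ℕ) : ℤ) = n - i - j := by omega
        rw [a0]
        have a1 : (n : ℤ) - i - j + i = n - j := by ring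
        have a2 : (n : ℤ) - i - j + j = n - i := by ring
        have a3 : (n : ℤ) - (n - i - j) - i = j := by ring
        have a4 : (n : ℤ) - (n - i - j) - j = i := by ring
        have a5 : (n : ℤ) + (n - i - j) - (n - i - j) = n := by ring
        rw [a1, a2, a3, a4, a5, sub_self, psG_zero]
        have b1 := psF_mul_psG (z := (n : ℤ) - i) (by omega)
        have b2 := psF_mul_psG (z := (n : ℤ) - j) (by omega)
        linear_combination (-(psF n * psG (n - i - j : ℤ) * psG i * psG j)) * (psF ((n : ℤ) - j) * psG ((n : ℤ) - j) * b1 + b2)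
    · intro m _ hm
      unfold psT
      rcases lt_or_gt_of_ne hm with h | h
      · rw [psG_neg (z := (m : ℤ) - (n - i - j)) (by omega)]; ring
      · rw [psG_neg (z := ((n - i - j : ℕ) : ℤ) - m) (by omega)]; ring
    · intro h; simp at h; omega
  | succ s h ih =>
    have h1 := psS_rec n i j s
    have h2 := psR_rec n i j s
    rw [ih, ← h2] at h1
    have p1 : ((s + 1 - (n - i - j) : ℤ) : ℚ) ≠ 0 := by
      rw [Int.cast_ne_zero]; omega
    have p2 : ((s + 1 : ℤ) : ℚ) ≠ 0 := by
      rw [Int.cast_ne_zero]; omega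
    exact mul_left_cancel₀ (mul_ne_zero p1 p2) h1

lemma psChoose (a b : ℕ) : (a.choose b : ℚ) = psF a * psG b * psG ((a : ℤ) - b) := by
  rcases le_or_gt b a with h | h
  · rw [← Nat.cast_sub h, psF_nat, psG_nat, psG_nat, Nat.cast_choose ℚ h]
    field_simp
  · rw [Nat.choose_eq_zero_of_lt h, psG_neg (z := (a : ℤ) - b) (by omega)]; simp

lemma psTerm (s n i j m : ℕ) (hm : m ≤ s) :
    (Nat.factorial s : ℚ) * (if (i : ℤ) + 1 + m ≤ ((n + 1 : ℕ) : ℤ) ∧ (j : ℤ) + 1 + m ≤ ((n + 1 : ℕ) : ℤ) ∧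
        ((n + 1 : ℕ) : ℤ) ≤ s + i + j + m + 1 then
            (s.choose m : ℚ) *
              ((((s : ℤ) + i + j + m + 1 - ((n + 1 : ℕ) : ℤ)).toNat.choose s : ℚ)) *
              (Nat.factorial (s - m + (n + 1) - 1) : ℚ) /
              ((Nat.factorial (((n + 1 : ℕ) : ℤ) - m - i - 1).toNat : ℚ) *
                (Nat.factorial (((n + 1 : ℕ) : ℤ) - m - j - 1).toNat : ℚ) *
                (Nat.factorial ((s : ℤ) + i + j + m + 1 - ((n + 1 : ℕ) : ℤ)).toNat : ℚ))
          else 0) = psF s * psT n i j s m := by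
  split_ifs with h
  · obtain ⟨h1, h2, h3⟩ := h
    obtain ⟨x, hx⟩ : ∃ x : ℕ, (s : ℤ) + i + j + m + 1 - ((n + 1 : ℕ) : ℤ) = x :=
      ⟨_, (Int.toNat_of_nonneg (by omega)).symm⟩
    obtain ⟨y, hy⟩ : ∃ y : ℕ, ((n + 1 : ℕ) : ℤ) - m - i - 1 = y :=
      ⟨_, (Int.toNat_of_nonneg (by omega)).symm⟩
    obtain ⟨z, hz⟩ : ∃ z : ℕ, ((n + 1 : ℕ) : ℤ) - m - j - 1 = z :=
      ⟨_, (Int.toNat_of_nonneg (by omega)).symm⟩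
    rw [hx, hy, hz, Int.toNat_natCast, Int.toNat_natCast, Int.toNat_natCast, psChoose, psChoose]
    unfold psT
    have c1 : (n : ℤ) - m - i = y := by rw [← hy]; push_cast; ring
    have c2 : (n : ℤ) - m - j = z := by rw [← hz]; push_cast; ring
    have c3 : (m : ℤ) - (n - i - j) = x - s := by rw [← hx]; push_cast; ring
    have c4 : (n : ℤ) + s - m = ((s - m + (n + 1) - 1 : ℕ) : ℤ) := by omega
    rw [c1, c2, c3, c4, psF_nat, psF_nat, psF_nat, psG_nat, psG_nat s, psG_nat y, psG_nat z]
    field_simp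
  · unfold psT
    have : psG (n - m - i) = 0 ∨ psG (n - m - j) = 0 ∨ psG (m - (n - i - j)) = 0 := by
      by_contra hc
      apply h
      refine ⟨?_, ?_, ?_⟩ <;> by_contra hh <;> apply hc
      · exact Or.inl (psG_neg (by push_cast at hh; omega))
      · exact Or.inr (Or.inl (psG_neg (by push_cast at hh; omega)))
      · exact Or.inr (Or.inr (psG_neg (by push_cast at hh; omega)))
    rcases this with h0 | h0 | h0 <;> rw [h0] <;> ring

lemma psSum (s n i j : ℕ) : ∑ m ∈ Finset.range (s + 1), psT n i j s m = psS n i j s := by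
  unfold psS
  have h1 : ∑ m ∈ Finset.range (s + 1), psT n i j s m
      = ∑ m ∈ Finset.range (n + s + 1), psT n i j s m := by
    apply Finset.sum_subset (Finset.range_subset_range.2 (by omega))
    intro m _ hm
    simp at hm
    unfold psT
    rw [psG_neg (z := (s : ℤ) - m) (by omega)]; ring
  have h2 : ∑ m ∈ Finset.range (n + 1), psT n i j s m
      = ∑ m ∈ Finset.range (n + s + 1), psT n i j s m := by
    apply Finset.sum_subset (Finset.range_subset_range.2 (by omega))
    intro m _ hm
    simp at hm
    unfold psT
    rw [psG_neg (z := (n : ℤ) - m - i) (by omega)]; ring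
  rw [h1, h2]

lemma psS_zero (s n i j : ℕ) (h : n < i ∨ n < j ∨ s + i + j < n) : psS n i j s = 0 := by
  unfold psS
  apply Finset.sum_eq_zero
  intro m _
  unfold psT
  rcases h with h | h | h
  · rw [psG_neg (z := (n : ℤ) - m - i) (by omega)]; ring
  · rw [psG_neg (z := (n : ℤ) - m - j) (by omega)]; ring
  · rcases le_or_gt m s with hm | hm
    · rw [psG_neg (z := (m : ℤ) - (n - i - j)) (by omega)]; ring
    · rw [psG_neg (z := (s : ℤ) - m) (by omega)]; ring

/-- The Pfaff–Saalschütz-type hypergeometric summation used to evaluate `R₁`: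
`s! ∑_{m=0}^{s} binom(s,m) binom(s+i+j+m-k+1, s) (s-m+k-1)! /
    [(k-m-i-1)! (k-m-j-1)! (s+i+j+m-k+1)!]
  = [(s+i)!(s+j)!/(s+i+j)!] binom(s+i+j, k-1) binom(k-1, i) binom(k-1, j)`,
where summands in which `k-m-i-1`, `k-m-j-1`, or `s+i+j+m-k+1` is negative are `0`. -/
theorem pfaff_saalschutz_sum (s k i j : ℕ) (hs : 1 ≤ s) (hk : 1 ≤ k) :
    (Nat.factorial s : ℚ) *
        ∑ m ∈ Finset.range (s + 1),
          (if (i : ℤ) + 1 + m ≤ k ∧ (j : ℤ) + 1 + m ≤ k ∧ (k : ℤ) ≤ s + i + j + m + 1 then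
            (s.choose m : ℚ) *
              ((((s : ℤ) + i + j + m + 1 - k).toNat.choose s : ℚ)) *
              (Nat.factorial (s - m + k - 1) : ℚ) /
              ((Nat.factorial ((k : ℤ) - m - i - 1).toNat : ℚ) *
                (Nat.factorial ((k : ℤ) - m - j - 1).toNat : ℚ) *
                (Nat.factorial ((s : ℤ) + i + j + m + 1 - k).toNat : ℚ))
          else 0) =
      ((Nat.factorial (s + i) : ℚ) * (Nat.factorial (s + j) : ℚ) /
          (Nat.factorial (s + i + j) : ℚ)) *
        ((s + i + j).choose (k - 1) : ℚ) * ((k - 1).choose i : ℚ) *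
        ((k - 1).choose j : ℚ) := by
  obtain ⟨n, rfl⟩ : ∃ n, k = n + 1 := ⟨k - 1, by omega⟩
  rw [Finset.mul_sum, Finset.sum_congr rfl
    (fun m hm => psTerm s n i j m (by simp at hm; omega)), ← Finset.mul_sum, psSum,
    Nat.add_sub_cancel]
  by_cases h : n < i ∨ n < j ∨ s + i + j < n
  · rw [psS_zero s n i j h]
    rcases h with h | h | h <;> simp [Nat.choose_eq_zero_of_lt h]
  · push Not at h
    obtain ⟨h1, h2, h3⟩ := h
    rw [psS_eq n i j s h1 h2 (by omega), psChoose, psChoose, psChoose]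
    unfold psR
    have c1 : (s : ℤ) - (n - i - j) = ((s + i + j : ℕ) : ℤ) - n := by push_cast; ring
    have c2 : (s : ℤ) + i = ((s + i : ℕ) : ℤ) := by push_cast; ring
    have c3 : (s : ℤ) + j = ((s + j : ℕ) : ℤ) := by push_cast; ring
    rw [c1, c2, c3]
    simp only [psF_nat, psG_nat]
    field_simp
end
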